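/- arXiv:1609.00215 — 2 statements merged into one kernel-verified Lean document; each statement's English description precedes it below -/
import Mathlib

section
/- The locally convex topology Σ is coarser than S (Remark 3.5): Let Σ be the locally convex topology on D([0,T]) generated by the seminorm ρ(x) = |x(T)| together with the seminorms ρ_𝒜(x) = sup_{A ∈ 𝒜} |∫_0^T x(u) dA(u)|, where 𝒜 runs over all relatively τ-compact subsets of 𝔸. Then a sequence (x_n) in D satisfies x_n ⇒*_S x_0 if and only if x_n → x_0 in Σ; consequently every Σ-open subset of D is S-open, i.e. Σ is coarser than the S topology. -/
open MeasureTheory Filter Set Topology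

noncomputable section

/-- `x` is càdlàg on `[0,T]`: right-continuous at every `t ∈ [0,T)` and
admitting a left limit at every `t ∈ (0,T]`. -/
def Cadlag (T : ℝ) (x : ℝ → ℝ) : Prop :=
  (∀ t ∈ Set.Ico (0:ℝ) T, Filter.Tendsto x (nhdsWithin t (Set.Ioi t)) (nhds (x t))) ∧
  (∀ t ∈ Set.Ioc (0:ℝ) T, ∃ L : ℝ, Filter.Tendsto x (nhdsWithin t (Set.Iio t)) (nhds L))

/-- membership in `𝕍`: càdlàg of finite total variation on `[0,T]`. -/
def MemV (T : ℝ) (v : ℝ → ℝ) : Prop :=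
  Cadlag T v ∧ BoundedVariationOn v (Set.Icc 0 T)

/-- `μ` is the finite signed (Lebesgue–Stieltjes) measure induced by `v` on `[0,T]`:
`μ([0,t]) = v(t)` for `t ∈ [0,T]`, and `μ` vanishes outside `[0,T]`. -/
def Represents (T : ℝ) (μ : MeasureTheory.SignedMeasure ℝ) (v : ℝ → ℝ) : Prop :=
  (∀ t ∈ Set.Icc (0:ℝ) T, μ (Set.Icc 0 t) = v t) ∧
  (∀ s : Set ℝ, MeasurableSet s → s ∩ Set.Icc (0:ℝ) T = ∅ → μ s = 0)

/-- Integral of `f` against a signed measure. -/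
noncomputable def sInt (μ : MeasureTheory.SignedMeasure ℝ) (f : ℝ → ℝ) : ℝ :=
  (∫ t, f t ∂μ.toJordanDecomposition.posPart) - (∫ t, f t ∂μ.toJordanDecomposition.negPart)

/-- `∫_{[0,T]} f dv` : integral of `f` with respect to the Lebesgue–Stieltjes
signed measure induced by `v` on `[0,T]`. -/
noncomputable def intD (T : ℝ) (f v : ℝ → ℝ) : ℝ :=
  letI := Classical.propDecidable (∃ μ : MeasureTheory.SignedMeasure ℝ, Represents T μ v)
  if h : ∃ μ : MeasureTheory.SignedMeasure ℝ, Represents T μ v then sInt h.choose f else 0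

/-- S-convergence `x_n →_S x₀` on `D([0,T])`. -/
def SConv (T : ℝ) (x : ℕ → ℝ → ℝ) (x₀ : ℝ → ℝ) : Prop :=
  ∀ ε > (0:ℝ), ∃ v : ℕ → ℝ → ℝ, ∃ v₀ : ℝ → ℝ,
    (∀ n, MemV T (v n)) ∧ MemV T v₀ ∧
    (∀ n, ∀ t ∈ Set.Icc (0:ℝ) T, |x n t - v n t| ≤ ε) ∧
    (∀ t ∈ Set.Icc (0:ℝ) T, |x₀ t - v₀ t| ≤ ε) ∧
    (∀ f : ℝ → ℝ, Continuous f →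
      Filter.Tendsto (fun n => intD T f (v n)) Filter.atTop (nhds (intD T f v₀)))

/-- `x_n ⇒*_S x₀` : every subsequence contains a further subsequence `→_S`-converging to `x₀`. -/
def SStarConv (T : ℝ) (x : ℕ → ℝ → ℝ) (x₀ : ℝ → ℝ) : Prop :=
  ∀ φ : ℕ → ℕ, StrictMono φ →
    ∃ ψ : ℕ → ℕ, StrictMono ψ ∧ SConv T (fun k => x (φ (ψ k))) x₀

/-- membership in `𝔸([0,T])`: continuous, of finite variation, vanishing at `0`. -/
def MemA (T : ℝ) (A : ℝ → ℝ) : Prop :=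
  ContinuousOn A (Set.Icc 0 T) ∧ BoundedVariationOn A (Set.Icc 0 T) ∧ A 0 = 0

/-- `A_n →_τ A₀` : uniform convergence on `[0,T]` together with uniformly bounded
total variations. -/
def TauConv (T : ℝ) (A : ℕ → ℝ → ℝ) (A₀ : ℝ → ℝ) : Prop :=
  TendstoUniformlyOn (fun n => A n) A₀ Filter.atTop (Set.Icc 0 T) ∧
  ∃ M : ℝ, ∀ n, eVariationOn (A n) (Set.Icc 0 T) ≤ ENNReal.ofReal M

/-- `x` has (at least) `k` up-crossings of the levels `a < b` on `[0,T]`. -/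
def HasUpcrossings (T a b : ℝ) (x : ℝ → ℝ) (k : ℕ) : Prop :=
  ∃ s u : Fin k → ℝ, (∀ i, 0 ≤ s i ∧ s i < u i ∧ u i ≤ T) ∧
    (∀ i j : Fin k, i < j → u i < s j) ∧
    (∀ i, x (s i) < a ∧ b < x (u i))

/-- `x` has (at least) `k` `η`-oscillations on `[0,T]`. -/
def HasOscillations (T η : ℝ) (x : ℝ → ℝ) (k : ℕ) : Prop :=
  ∃ s u : Fin k → ℝ, (∀ i, 0 ≤ s i ∧ s i < u i ∧ u i ≤ T) ∧
    (∀ i j : Fin k, i < j → u i ≤ s j) ∧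
    (∀ i, |x (u i) - x (s i)| > η)


/-- `𝒜 ⊆ 𝔸([0,T])` is relatively `τ`-compact: every sequence in `𝒜` has a
`→_τ`-convergent subsequence with limit in `𝔸([0,T])`. -/
def RelTauCompact (T : ℝ) (𝒜 : Set (ℝ → ℝ)) : Prop :=
  ∀ A : ℕ → ℝ → ℝ, (∀ n, A n ∈ 𝒜) →
    ∃ φ : ℕ → ℕ, StrictMono φ ∧ ∃ A₀ : ℝ → ℝ, MemA T A₀ ∧ TauConv T (fun k => A (φ k)) A₀

/-- the Skorokhod space `D([0,T])` as a subset of `ℝ → ℝ`. -/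
def Dset (T : ℝ) : Set (ℝ → ℝ) := {x | Cadlag T x}

/-- `U ⊆ D([0,T])` is `S`-open: its complement within `D([0,T])` is closed under
`→_S`-convergence of sequences. -/
def SOpen (T : ℝ) (U : Set (ℝ → ℝ)) : Prop :=
  U ⊆ Dset T ∧
  ∀ x : ℕ → ℝ → ℝ, (∀ n, x n ∈ Dset T \ U) → ∀ x₀ ∈ Dset T, SConv T x x₀ → x₀ ∉ U

/-- `U` is open in the locally convex topology `Σ` on `D([0,T])`, generated by the
seminorm `ρ(x) = |x T|` and the seminorms `ρ_𝒜(x) = sup_{A ∈ 𝒜} |∫_0^T x dA|`, where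
`𝒜` runs over the relatively `τ`-compact subsets of `𝔸` (a basic `Σ`-neighborhood of
`x₀` is given by one radius `δ` and one family `𝒜`, since finite unions of relatively
`τ`-compact families are relatively `τ`-compact). -/
def SigmaOpen (T : ℝ) (U : Set (ℝ → ℝ)) : Prop :=
  U ⊆ Dset T ∧
  ∀ x₀ ∈ U, ∃ δ > (0:ℝ), ∃ 𝒜 : Set (ℝ → ℝ),
    (∀ A ∈ 𝒜, MemA T A) ∧ RelTauCompact T 𝒜 ∧
    ∀ y ∈ Dset T, |y T - x₀ T| < δ →
      (∀ A ∈ 𝒜, |intD T (fun u => y u - x₀ u) A| < δ) → y ∈ U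

/-- `A` is the distribution function on `[0,T]` of the difference `p - q` of two finite measures
carried by `[0,T]`. -/
structure StieltjesPair (T : ℝ) (p q : Measure ℝ) (A : ℝ → ℝ) : Prop where
  finite_left : IsFiniteMeasure p
  finite_right : IsFiniteMeasure q
  support_left : p (Icc 0 T)ᶜ = 0
  support_right : q (Icc 0 T)ᶜ = 0
  eq_sub : ∀ t ∈ Icc 0 T, A t = p.real (Icc 0 t) - q.real (Icc 0 t)

/-- `f` is bounded and Borel measurable on `[0,T]`. -/
structure BddMeasOn (T : ℝ) (f : ℝ → ℝ) : Prop where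
  measurable_indicator : Measurable ((Icc 0 T).indicator f)
  bounded : ∃ K : ℝ, ∀ t ∈ Icc 0 T, |f t| ≤ K

lemma ae_mem_Icc_of_support {T : ℝ} {p : Measure ℝ} (hp : p (Icc 0 T)ᶜ = 0) :
    ∀ᵐ t ∂p, t ∈ Icc 0 T := by
  rw [ae_iff]
  exact hp

lemma BddMeasOn.integrable {T : ℝ} {f : ℝ → ℝ} (hf : BddMeasOn T f) {p : Measure ℝ}
    [IsFiniteMeasure p] (hp : p (Icc 0 T)ᶜ = 0) : Integrable f p := by
  obtain ⟨K, hK⟩ := hf.bounded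
  have hae := ae_mem_Icc_of_support hp
  refine Integrable.of_bound (C := K) ⟨_, hf.measurable_indicator.stronglyMeasurable, ?_⟩ ?_
  · filter_upwards [hae] with t ht
    rw [indicator_of_mem ht]
  · filter_upwards [hae] with t ht using hK t ht

lemma BddMeasOn.sub {T : ℝ} {f g : ℝ → ℝ} (hf : BddMeasOn T f) (hg : BddMeasOn T g) :
    BddMeasOn T (fun t => f t - g t) := by
  obtain ⟨K, hK⟩ := hf.bounded
  obtain ⟨L, hL⟩ := hg.bounded
  refine ⟨?_, K + L, fun t ht => ?_⟩
  · convert hf.measurable_indicator.sub hg.measurable_indicator using 1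
    exact indicator_sub _ f g
  · exact (abs_sub _ _).trans (add_le_add (hK t ht) (hL t ht))

lemma BddMeasOn.of_continuousOn {T : ℝ} {f : ℝ → ℝ} (hf : ContinuousOn f (Icc 0 T)) :
    BddMeasOn T f := by
  refine ⟨?_, ?_⟩
  · convert hf.measurable_piecewise (continuousOn_const (c := (0 : ℝ))) measurableSet_Icc using 1
    exact (piecewise_eq_indicator).symm
  · obtain ⟨K, hK⟩ := isCompact_Icc.exists_bound_of_continuousOn hf
    exact ⟨K, hK⟩

/-- Measurability and boundedness pass to uniform limits. -/
lemma BddMeasOn.of_approx {T : ℝ} {f : ℝ → ℝ}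
    (h : ∀ ε > (0 : ℝ), ∃ g, BddMeasOn T g ∧ ∀ t ∈ Icc 0 T, |f t - g t| ≤ ε) :
    BddMeasOn T f := by
  refine ⟨?_, ?_⟩
  · choose g hg hfg using fun n : ℕ => h (1 / ((n : ℝ) + 1)) Nat.one_div_pos_of_nat
    refine measurable_of_tendsto_metrizable (fun n => (hg n).measurable_indicator) ?_
    rw [tendsto_pi_nhds]
    intro t
    by_cases ht : t ∈ Icc 0 T
    · simp only [indicator_of_mem ht]
      rw [tendsto_iff_dist_tendsto_zero]
      refine squeeze_zero (fun _ => dist_nonneg) (fun n => ?_)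
        (tendsto_one_div_add_atTop_nhds_zero_nat (𝕜 := ℝ))
      rw [dist_comm, Real.dist_eq]
      exact hfg n t ht
    · simp only [indicator_of_notMem ht]
      exact tendsto_const_nhds
  · obtain ⟨g, hg, hfg⟩ := h 1 one_pos
    obtain ⟨K, hK⟩ := hg.bounded
    refine ⟨1 + K, fun t ht => ?_⟩
    have := abs_sub_abs_le_abs_sub (f t) (g t)
    linarith [hfg t ht, hK t ht]

lemma measureReal_Iic_eq_of_support {T : ℝ} {p : Measure ℝ} (hp : p (Icc 0 T)ᶜ = 0) (t : ℝ) :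
    p.real (Iic t) = p.real (Icc 0 t) := by
  refine measureReal_congr ?_
  filter_upwards [ae_mem_Icc_of_support hp] with s hs
  exact propext ⟨fun h => ⟨hs.1, h⟩, fun h => h.2⟩

lemma Represents.pos_neg_support {T : ℝ} {μ : SignedMeasure ℝ} {v : ℝ → ℝ}
    (h : Represents T μ v) :
    μ.toJordanDecomposition.posPart (Icc 0 T)ᶜ = 0 ∧
      μ.toJordanDecomposition.negPart (Icc 0 T)ᶜ = 0 := by
  obtain ⟨i, hi, h1, h2, h3, h4⟩ := μ.toJordanDecomposition_spec
  have hm : MeasurableSet (Icc 0 T : Set ℝ)ᶜ := measurableSet_Icc.compl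
  rw [h3, h4, SignedMeasure.toMeasureOfZeroLE_apply _ _ hi hm,
    SignedMeasure.toMeasureOfLEZero_apply _ _ hi.compl hm]
  constructor
  · have := h.2 (i ∩ (Icc 0 T)ᶜ) (hi.inter hm) (by ext; simp)
    simp [this]
  · have := h.2 (iᶜ ∩ (Icc 0 T)ᶜ) (hi.compl.inter hm) (by ext; simp)
    simp [this]

/-- The two parts of the Jordan decomposition of a representing signed measure. -/
lemma Represents.stieltjesPair {T : ℝ} {μ : SignedMeasure ℝ} {v : ℝ → ℝ}
    (h : Represents T μ v) :
    StieltjesPair T μ.toJordanDecomposition.posPart μ.toJordanDecomposition.negPart v := by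
  refine ⟨inferInstance, inferInstance, h.pos_neg_support.1, h.pos_neg_support.2,
    fun t ht => ?_⟩
  rw [← h.1 t ht]
  conv_lhs => rw [← μ.toSignedMeasure_toJordanDecomposition]
  simp [JordanDecomposition.toSignedMeasure]

lemma StieltjesPair.represents {T : ℝ} {p q : Measure ℝ} {A : ℝ → ℝ}
    (h : StieltjesPair T p q A) : ∃ μ : SignedMeasure ℝ, Represents T μ A := by
  have := h.finite_left
  have := h.finite_right
  refine ⟨p.toSignedMeasure - q.toSignedMeasure, fun t ht => ?_, fun s hs hsT => ?_⟩
  · simp [h.eq_sub t ht]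
  · have hsub : s ⊆ (Icc 0 T)ᶜ := fun t ht hT => by
      have : t ∈ s ∩ Icc 0 T := ⟨ht, hT⟩
      simp [hsT] at this
    simp [Measure.toSignedMeasure_apply_measurable hs, measureReal_def,
      measure_mono_null hsub h.support_left, measure_mono_null hsub h.support_right]

/-- Two pairs with the same distribution function give the same integrals. -/
lemma StieltjesPair.integral_sub_eq {T : ℝ} (hT : 0 < T) {p q p' q' : Measure ℝ} {A f : ℝ → ℝ}
    (h : StieltjesPair T p q A) (h' : StieltjesPair T p' q' A) (hf : BddMeasOn T f) :
    ∫ t, f t ∂p' - ∫ t, f t ∂q' = ∫ t, f t ∂p - ∫ t, f t ∂q := by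
  have := h.finite_left
  have := h.finite_right
  have := h'.finite_left
  have := h'.finite_right
  have key : p' + q = p + q' := by
    refine Measure.ext_of_Iic _ _ fun t => ?_
    rw [← measureReal_eq_measureReal_iff, measureReal_add_apply, measureReal_add_apply,
      measureReal_Iic_eq_of_support h.support_left, measureReal_Iic_eq_of_support h.support_right,
      measureReal_Iic_eq_of_support h'.support_left,
      measureReal_Iic_eq_of_support h'.support_right]
    rcases lt_or_ge t 0 with ht | ht
    · simp [Icc_eq_empty (not_le.2 ht)]
    · have hcut : ∀ r : Measure ℝ, r (Icc 0 T)ᶜ = 0 →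
          r.real (Icc 0 t) = r.real (Icc 0 (min t T)) := by
        intro r hr
        refine measureReal_congr ?_
        filter_upwards [ae_mem_Icc_of_support hr] with s hs
        refine propext ⟨fun h => ⟨h.1, le_min h.2 hs.2⟩,
          fun h => ⟨h.1, h.2.trans (min_le_left _ _)⟩⟩
      rw [hcut p h.support_left, hcut q h.support_right, hcut p' h'.support_left,
        hcut q' h'.support_right]
      have hm : min t T ∈ Icc 0 T := ⟨le_min ht hT.le, min_le_right _ _⟩
      linarith [h.eq_sub _ hm, h'.eq_sub _ hm]
  have : ∫ t, f t ∂(p' + q) = ∫ t, f t ∂(p + q') := by rw [key]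
  rw [integral_add_measure (hf.integrable h'.support_left) (hf.integrable h.support_right),
    integral_add_measure (hf.integrable h.support_left) (hf.integrable h'.support_right)] at this
  linarith

lemma StieltjesPair.intD_eq {T : ℝ} (hT : 0 < T) {p q : Measure ℝ} {A f : ℝ → ℝ}
    (h : StieltjesPair T p q A) (hf : BddMeasOn T f) :
    intD T f A = ∫ t, f t ∂p - ∫ t, f t ∂q := by
  have hex := h.represents
  rw [intD, dif_pos hex]
  exact h.integral_sub_eq hT hex.choose_spec.stieltjesPair hf

lemma StieltjesPair.intD_sub {T : ℝ} (hT : 0 < T) {p q : Measure ℝ} {A f g : ℝ → ℝ}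
    (h : StieltjesPair T p q A) (hf : BddMeasOn T f) (hg : BddMeasOn T g) :
    intD T (fun t => f t - g t) A = intD T f A - intD T g A := by
  have := h.finite_left
  have := h.finite_right
  rw [h.intD_eq hT hf, h.intD_eq hT hg, h.intD_eq hT (hf.sub hg),
    integral_sub (hf.integrable h.support_left) (hg.integrable h.support_left),
    integral_sub (hf.integrable h.support_right) (hg.integrable h.support_right)]
  ring

lemma abs_integral_le_of_support {T K : ℝ} {p : Measure ℝ} [IsFiniteMeasure p] {f : ℝ → ℝ}
    (hp : p (Icc 0 T)ᶜ = 0) (hK : ∀ t ∈ Icc 0 T, |f t| ≤ K) :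
    |∫ t, f t ∂p| ≤ K * p.real univ := by
  rw [← Real.norm_eq_abs]
  refine norm_integral_le_of_norm_le_const ?_
  filter_upwards [ae_mem_Icc_of_support hp] with t ht using hK t ht

lemma StieltjesPair.abs_intD_le {T : ℝ} (hT : 0 < T) {p q : Measure ℝ} {A f : ℝ → ℝ}
    (h : StieltjesPair T p q A) (hf : BddMeasOn T f) {K : ℝ} (hK : ∀ t ∈ Icc 0 T, |f t| ≤ K) :
    |intD T f A| ≤ K * (p.real univ + q.real univ) := by
  have := h.finite_left
  have := h.finite_right
  rw [h.intD_eq hT hf, mul_add]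
  exact (abs_sub _ _).trans (add_le_add (abs_integral_le_of_support h.support_left hK)
    (abs_integral_le_of_support h.support_right hK))

/-- A right-continuous function of bounded variation is the distribution function of a difference
of two finite measures whose masses are controlled by the variation. -/
lemma exists_stieltjesPair {T : ℝ} (hT : 0 < T) {v : ℝ → ℝ}
    (hr : ∀ t ∈ Ico 0 T, Tendsto v (𝓝[>] t) (𝓝 (v t)))
    (hv : BoundedVariationOn v (Icc 0 T)) :
    ∃ p q : Measure ℝ, StieltjesPair T p q v ∧
      p.real univ + q.real univ ≤ 3 * (eVariationOn v (Icc 0 T)).toReal + |v 0| := by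
  set c : ℝ → ℝ := fun t => max 0 (min t T) with hc
  have hcm : Monotone c := fun a b hab => max_le_max le_rfl (min_le_min hab le_rfl)
  have hcmem : ∀ t, c t ∈ Icc 0 T := fun t => ⟨le_max_left _ _, max_le hT.le (min_le_right _ _)⟩
  have hcid : ∀ t ∈ Icc 0 T, c t = t := fun t ht => by simp [hc, ht.1, ht.2]
  set w : ℝ → ℝ := v ∘ c with hw
  have hwle : eVariationOn w univ ≤ eVariationOn v (Icc 0 T) :=
    eVariationOn.comp_le_of_monotoneOn v c (hcm.monotoneOn _) (fun t _ => hcmem t)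
  have hwbv : BoundedVariationOn w univ := ne_top_of_le_ne_top hv hwle
  have hwr : ∀ t, ContinuousWithinAt w (Ici t) t := by
    intro t
    rcases lt_or_ge t T with htT | htT
    · have hct : c t ∈ Ico 0 T := ⟨(hcmem t).1, max_lt hT ((min_le_left _ _).trans_lt htT)⟩
      have h1 : ContinuousWithinAt v (Ici (c t)) (c t) := by
        rw [← continuousWithinAt_Ioi_iff_Ici]
        exact hr _ hct
      have h2 : Continuous c := by fun_prop
      exact h1.comp h2.continuousWithinAt (fun s hs => hcm hs)
    · refine (continuousWithinAt_const : ContinuousWithinAt (fun _ : ℝ => v T) _ _).congr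
        (fun s hs => ?_) ?_
      · simp [hw, hc, htT.trans (mem_Ici.1 hs), hT.le]
      · simp [hw, hc, htT, hT.le]
  set V : ℝ → ℝ := variationOnFromTo w univ 0 with hV
  have hVr : ∀ t, ContinuousWithinAt V (Ici t) t := fun t =>
    hwbv.continuousWithinAt_variationOnFromTo_Ici (hwr t)
  have hVm : Monotone V := monotoneOn_univ.1
    (variationOnFromTo.monotoneOn hwbv.locallyBoundedVariationOn (mem_univ _))
  have hWm : Monotone (V - w) := monotoneOn_univ.1
    (variationOnFromTo.sub_self_monotoneOn hwbv.locallyBoundedVariationOn (mem_univ _))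
  have hV0 : V 0 = 0 := variationOnFromTo.self _ _ _
  have hw0 : w 0 = v 0 := by simp [hw, hcid 0 ⟨le_rfl, hT.le⟩]
  have hVT : V T ≤ (eVariationOn v (Icc 0 T)).toReal :=
    (le_abs_self _).trans ((variationOnFromTo.abs_le_eVariationOn hwbv).trans
      (ENNReal.toReal_mono hv hwle))
  have hwT : |w T - w 0| ≤ V T - V 0 := variationOnFromTo.abs_sub_le_sub_of_le
    hwbv.locallyBoundedVariationOn (mem_univ _) (mem_univ _) (mem_univ _) hT.le
  let F : StieltjesFunction ℝ := ⟨V, hVm, hVr⟩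
  let G : StieltjesFunction ℝ := ⟨V - w, hWm, fun t => (hVr t).sub (hwr t)⟩
  have aux : ∀ (H : StieltjesFunction ℝ) (a : ℝ), 0 ≤ a →
      ∃ r : Measure ℝ, IsFiniteMeasure r ∧ r (Icc 0 T)ᶜ = 0 ∧
        ∀ t ∈ Icc 0 T, r.real (Icc 0 t) = H t - H 0 + a := by
    intro H a ha
    have : IsFiniteMeasure (H.measure.restrict (Ioc 0 T)) := ⟨by simp⟩
    have : IsFiniteMeasure (ENNReal.ofReal a • Measure.dirac (0 : ℝ)) := ⟨by simp⟩
    refine ⟨H.measure.restrict (Ioc 0 T) + ENNReal.ofReal a • Measure.dirac 0, inferInstance,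
      ?_, fun t ht => ?_⟩
    · have h1 : (Icc 0 T)ᶜ ∩ Ioc 0 T = ∅ := by
        ext s; simp only [mem_inter_iff, mem_compl_iff, mem_Icc, mem_Ioc, mem_empty_iff_false]
        grind
      rw [Measure.add_apply, Measure.restrict_apply measurableSet_Icc.compl, h1]
      simp [hT.le]
    · have h1 : Icc 0 t ∩ Ioc 0 T = Ioc 0 t := by
        ext s
        have := ht.2
        simp only [mem_inter_iff, mem_Icc, mem_Ioc]
        grind
      rw [measureReal_add_apply, measureReal_restrict_apply measurableSet_Icc, h1]
      simp [measureReal_def, ht.1, ha, H.mono ht.1]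
  obtain ⟨p, hp, hps, hpt⟩ := aux F (max (v 0) 0) (le_max_right _ _)
  obtain ⟨q, hq, hqs, hqt⟩ := aux G (max (-v 0) 0) (le_max_right _ _)
  have hF : ∀ t, F t = V t := fun _ => rfl
  have hG : ∀ t, G t = V t - w t := fun _ => rfl
  have hpos : max (v 0) 0 - max (-v 0) 0 = v 0 := max_zero_sub_max_neg_zero_eq_self _
  have habs : max (v 0) 0 + max (-v 0) 0 = |v 0| := max_zero_add_max_neg_zero_eq_abs_self _
  refine ⟨p, q, ⟨hp, hq, hps, hqs, fun t ht => ?_⟩, ?_⟩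
  · rw [hpt t ht, hqt t ht, hF, hF, hG, hG, hw0]
    have : w t = v t := by simp [hw, hcid t ht]
    linarith
  · have hTT : T ∈ Icc 0 T := ⟨hT.le, le_rfl⟩
    have huniv : ∀ r : Measure ℝ, r (Icc 0 T)ᶜ = 0 → r.real univ = r.real (Icc 0 T) := by
      intro r hr
      refine measureReal_congr ?_
      filter_upwards [ae_mem_Icc_of_support hr] with s hs
      exact propext ⟨fun _ => hs, fun _ => trivial⟩
    rw [huniv p hps, huniv q hqs, hpt T hTT, hqt T hTT, hF, hF, hG, hG]
    have := (abs_le.1 hwT).1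
    linarith

lemma integral_measureReal_Iic (p r : Measure ℝ) [IsFiniteMeasure p] [IsFiniteMeasure r] :
    ∫ u, p.real (Iic u) ∂r = ∫ s, r.real (Ici s) ∂p := by
  have hm : MeasurableSet {z : ℝ × ℝ | z.1 ≤ z.2} := measurableSet_le measurable_fst measurable_snd
  have h1 := Measure.prod_apply (μ := p) (ν := r) hm
  have h2 := Measure.prod_apply_symm (μ := p) (ν := r) hm
  have e1 : ∀ s : ℝ, Prod.mk s ⁻¹' {z : ℝ × ℝ | z.1 ≤ z.2} = Ici s := fun s => rfl
  have e2 : ∀ u : ℝ, (fun s => (s, u)) ⁻¹' {z : ℝ × ℝ | z.1 ≤ z.2} = Iic u := fun u => rfl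
  simp only [e1] at h1
  simp only [e2] at h2
  simp only [measureReal_def]
  rw [integral_toReal, integral_toReal, ← h1, ← h2]
  · simpa only [e1] using (measurable_measure_prodMk_left (ν := r) hm).aemeasurable
  · exact ae_of_all _ fun s => measure_lt_top _ _
  · simpa only [e2] using (measurable_measure_prodMk_right (μ := p) hm).aemeasurable
  · exact ae_of_all _ fun s => measure_lt_top _ _

lemma StieltjesPair.sub_Ici_eq {T : ℝ} {p q : Measure ℝ} {A : ℝ → ℝ}
    (h : StieltjesPair T p q A) (hA : ContinuousOn A (Icc 0 T)) (hA0 : A 0 = 0)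
    {s : ℝ} (hs : s ∈ Icc 0 T) : p.real (Ici s) - q.real (Ici s) = A T - A s := by
  have := h.finite_left
  have := h.finite_right
  have hT0 : (0 : ℝ) ≤ T := hs.1.trans hs.2
  have huniv : ∀ r : Measure ℝ, IsFiniteMeasure r → r (Icc 0 T)ᶜ = 0 →
      r.real (Ici s) = r.real (Icc 0 T) - r.real (Iio s) := by
    intro r _ hr
    have h1 : r.real univ = r.real (Icc 0 T) := by
      refine measureReal_congr ?_
      filter_upwards [ae_mem_Icc_of_support hr] with s hs
      exact propext ⟨fun _ => hs, fun _ => trivial⟩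
    have h2 := measureReal_compl (μ := r) (measurableSet_Iio (a := s))
    rw [compl_Iio] at h2
    rw [h2, h1]
  suffices hlt : p.real (Iio s) - q.real (Iio s) = A s by
    rw [huniv p h.finite_left h.support_left, huniv q h.finite_right h.support_right,
      h.eq_sub T ⟨hT0, le_rfl⟩]
    linarith
  rcases hs.1.eq_or_lt with rfl | hs0
  · have hz : ∀ r : Measure ℝ, r (Icc 0 T)ᶜ = 0 → r.real (Iio 0) = 0 := fun r hr => by
      rw [measureReal_def, measure_mono_null _ hr, ENNReal.toReal_zero]
      exact fun t ht h => absurd h.1 (not_le.2 ht)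
    rw [hz p h.support_left, hz q h.support_right, hA0, sub_zero]
  · obtain ⟨u, hum, hu, hut⟩ := exists_seq_strictMono_tendsto' hs0
    have hU : ⋃ n, Iic (u n) = Iio s := by
      ext t
      simp only [mem_iUnion, mem_Iic, mem_Iio]
      refine ⟨fun ⟨n, hn⟩ => hn.trans_lt (hu n).2, fun ht => ?_⟩
      obtain ⟨n, hn⟩ := (hut.eventually (lt_mem_nhds ht)).exists
      exact ⟨n, hn.le⟩
    have hlim : ∀ r : Measure ℝ, IsFiniteMeasure r →
        Tendsto (fun n => r.real (Iic (u n))) atTop (𝓝 (r.real (Iio s))) := by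
      intro r _
      have := tendsto_measure_iUnion_atTop (μ := r)
        (s := fun n => Iic (u n)) (fun a b hab => Iic_subset_Iic.2 (hum.monotone hab))
      rw [hU] at this
      exact (ENNReal.tendsto_toReal (measure_ne_top _ _)).comp this
    have huI : ∀ n, u n ∈ Icc 0 T := fun n => ⟨(hu n).1.le, (hu n).2.le.trans hs.2⟩
    have h1 : Tendsto (fun n => A (u n)) atTop (𝓝 (A s)) :=
      ((hA s hs).tendsto).comp (tendsto_nhdsWithin_iff.2 ⟨hut, Eventually.of_forall huI⟩)
    refine tendsto_nhds_unique (((hlim p h.finite_left).sub (hlim q h.finite_right))) ?_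
    refine h1.congr fun n => ?_
    rw [h.eq_sub _ (huI n), measureReal_Iic_eq_of_support h.support_left,
      measureReal_Iic_eq_of_support h.support_right]

/-- Integration by parts against a continuous integrator vanishing at `0`. -/
lemma StieltjesPair.intD_by_parts {T : ℝ} (hT : 0 < T) {p q p' q' : Measure ℝ} {v A : ℝ → ℝ}
    (hv : StieltjesPair T p q v) (hvm : BddMeasOn T v) (h : StieltjesPair T p' q' A)
    (hA : ContinuousOn A (Icc 0 T)) (hA0 : A 0 = 0) :
    intD T v A = intD T (fun s => A T - A s) v := by
  have := h.finite_left
  have := h.finite_right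
  have := hv.finite_left
  have := hv.finite_right
  have hg : BddMeasOn T (fun s => A T - A s) :=
    .of_continuousOn (continuousOn_const.sub hA)
  rw [h.intD_eq hT hvm, hv.intD_eq hT hg]
  have hanti : ∀ (r r' : Measure ℝ) [IsFiniteMeasure r] [IsFiniteMeasure r'],
      Integrable (fun s => r.real (Ici s)) r' := by
    intro r r' _ _
    refine Integrable.of_bound (C := r.real univ) ?_ ?_
    · have : Antitone (fun s => r.real (Ici s)) := fun a b hab =>
        measureReal_mono (Ici_subset_Ici.2 hab)
      exact this.measurable.aestronglyMeasurable
    · refine ae_of_all _ fun s => ?_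
      rw [Real.norm_eq_abs, abs_of_nonneg measureReal_nonneg]
      exact measureReal_mono (subset_univ _)
  have hmono : ∀ (r r' : Measure ℝ) [IsFiniteMeasure r] [IsFiniteMeasure r'],
      Integrable (fun s => r.real (Iic s)) r' := by
    intro r r' _ _
    refine Integrable.of_bound (C := r.real univ) ?_ ?_
    · have : Monotone (fun s => r.real (Iic s)) := fun a b hab =>
        measureReal_mono (Iic_subset_Iic.2 hab)
      exact this.measurable.aestronglyMeasurable
    · refine ae_of_all _ fun s => ?_
      rw [Real.norm_eq_abs, abs_of_nonneg measureReal_nonneg]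
      exact measureReal_mono (subset_univ _)
  have h1 : ∀ (r : Measure ℝ) [IsFiniteMeasure r], r (Icc 0 T)ᶜ = 0 →
      ∫ t, v t ∂r = ∫ t, p.real (Iic t) ∂r - ∫ t, q.real (Iic t) ∂r := by
    intro r _ hr
    rw [← integral_sub (hmono p r) (hmono q r)]
    refine integral_congr_ae ?_
    filter_upwards [ae_mem_Icc_of_support hr] with t ht
    rw [hv.eq_sub t ht, measureReal_Iic_eq_of_support hv.support_left,
      measureReal_Iic_eq_of_support hv.support_right]
  have h2 : ∀ (r : Measure ℝ) [IsFiniteMeasure r], r (Icc 0 T)ᶜ = 0 →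
      ∫ t, (A T - A t) ∂r = ∫ t, p'.real (Ici t) ∂r - ∫ t, q'.real (Ici t) ∂r := by
    intro r _ hr
    rw [← integral_sub (hanti p' r) (hanti q' r)]
    refine integral_congr_ae ?_
    filter_upwards [ae_mem_Icc_of_support hr] with t ht
    rw [h.sub_Ici_eq hA hA0 ht]
  rw [h1 p' h.support_left, h1 q' h.support_right, h2 p hv.support_left, h2 q hv.support_right]
  simp only [integral_measureReal_Iic]
  ring

/-- The step function with jumps `c i` at the points `t i`. -/
def stepFun {m : ℕ} (c t : Fin m → ℝ) (u : ℝ) : ℝ := ∑ i, if t i ≤ u then c i else 0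

lemma stepFun_snoc {m : ℕ} (c t : Fin m → ℝ) (a b u : ℝ) :
    stepFun (Fin.snoc c a : Fin (m + 1) → ℝ) (Fin.snoc t b : Fin (m + 1) → ℝ) u =
      stepFun c t u + if b ≤ u then a else 0 := by
  simp [stepFun, Fin.sum_univ_castSucc]

lemma stepFun_cons {m : ℕ} (c t : Fin m → ℝ) (a b u : ℝ) :
    stepFun (Fin.cons a c : Fin (m + 1) → ℝ) (Fin.cons b t : Fin (m + 1) → ℝ) u =
      (if b ≤ u then a else 0) + stepFun c t u := by
  simp [stepFun, Fin.sum_univ_succ]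

lemma stepFun_eq_sum {m : ℕ} {c t : Fin m → ℝ} {u : ℝ} (h : ∀ i, t i ≤ u) :
    stepFun c t u = ∑ i, c i := by
  simp [stepFun, h]

lemma stepFun_eq_zero {m : ℕ} {c t : Fin m → ℝ} {u : ℝ} (h : ∀ i, u < t i) :
    stepFun c t u = 0 := by
  simp [stepFun, fun i => not_le.2 (h i)]

lemma stepFun_bddMeasOn {m : ℕ} (c t : Fin m → ℝ) (T : ℝ) : BddMeasOn T (stepFun c t) := by
  refine ⟨Measurable.indicator ?_ measurableSet_Icc, ∑ i, |c i|, fun u _ => ?_⟩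
  · unfold stepFun
    refine Finset.measurable_sum _ fun i _ => ?_
    exact Measurable.ite measurableSet_Ici measurable_const measurable_const
  · refine (Finset.abs_sum_le_sum_abs _ _).trans (Finset.sum_le_sum fun i _ => ?_)
    split_ifs <;> simp

lemma stepFun_cadlag {m : ℕ} (c t : Fin m → ℝ) (T : ℝ) : Cadlag T (stepFun c t) := by
  refine ⟨fun s _ => ?_, fun s _ => ⟨∑ i, if t i < s then c i else 0, ?_⟩⟩
  · refine tendsto_finsetSum _ fun i _ => ?_
    refine tendsto_const_nhds.congr' ?_
    rcases le_or_gt (t i) s with h | h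
    · filter_upwards [self_mem_nhdsWithin] with u hu
      simp [h, h.trans (le_of_lt hu)]
    · filter_upwards [mem_nhdsWithin_of_mem_nhds (Iio_mem_nhds h)] with u hu
      simp [not_le.2 h, not_le.2 (mem_Iio.1 hu)]
  · refine tendsto_finsetSum _ fun i _ => ?_
    refine tendsto_const_nhds.congr' ?_
    rcases lt_or_ge (t i) s with h | h
    · filter_upwards [mem_nhdsWithin_of_mem_nhds (Ioi_mem_nhds h)] with u hu
      simp [h, (mem_Ioi.1 hu).le]
    · filter_upwards [self_mem_nhdsWithin] with u hu
      simp [not_lt.2 h, (mem_Iio.1 hu).trans_le h]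

lemma stepFun_stieltjesPair {m : ℕ} (c : Fin m → ℝ) {t : Fin m → ℝ} {T : ℝ}
    (ht : ∀ i, t i ∈ Icc 0 T) :
    StieltjesPair T (∑ i, ENNReal.ofReal (c i) • Measure.dirac (t i))
      (∑ i, ENNReal.ofReal (-c i) • Measure.dirac (t i)) (stepFun c t) := by
  have hfin : ∀ d : Fin m → ℝ,
      IsFiniteMeasure (∑ i, ENNReal.ofReal (d i) • Measure.dirac (t i)) := fun d =>
    ⟨by simp [Measure.finsetSum_apply, ENNReal.sum_lt_top]⟩
  have hsupp : ∀ d : Fin m → ℝ,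
      (∑ i, ENNReal.ofReal (d i) • Measure.dirac (t i)) (Icc 0 T)ᶜ = 0 := fun d => by
    rw [Measure.finsetSum_apply]
    refine Finset.sum_eq_zero fun i _ => ?_
    have := ht i
    simp [this.1, this.2]
  refine ⟨hfin c, hfin (fun i => -c i), hsupp c, hsupp (fun i => -c i), fun u hu => ?_⟩
  have hval : ∀ d : Fin m → ℝ,
      (∑ i, ENNReal.ofReal (d i) • Measure.dirac (t i)).real (Icc 0 u) =
        ∑ i, if t i ≤ u then max (d i) 0 else 0 := fun d => by
    rw [measureReal_def, Measure.finsetSum_apply, ENNReal.toReal_sum]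
    · refine Finset.sum_congr rfl fun i _ => ?_
      have := ht i
      by_cases h : t i ≤ u <;> simp [this.1, h, indicator, ENNReal.toReal_ofReal']
    · intro i _
      simp only [Measure.smul_apply, smul_eq_mul]
      exact ENNReal.mul_ne_top ENNReal.ofReal_ne_top (measure_ne_top _ _)
  rw [hval c, hval (fun i => -c i), ← Finset.sum_sub_distrib]
  refine Finset.sum_congr rfl fun i _ => ?_
  split_ifs
  · exact (max_zero_sub_max_neg_zero_eq_self _).symm
  · simp

lemma intD_stepFun {m : ℕ} (c : Fin m → ℝ) {t : Fin m → ℝ} {T : ℝ} (hT : 0 < T)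
    (ht : ∀ i, t i ∈ Icc 0 T) {f : ℝ → ℝ} (hf : BddMeasOn T f) :
    intD T f (stepFun c t) = ∑ i, c i * f (t i) := by
  have hint : ∀ d : Fin m → ℝ,
      ∫ s, f s ∂(∑ i, ENNReal.ofReal (d i) • Measure.dirac (t i)) =
        ∑ i, max (d i) 0 * f (t i) := fun d => by
    rw [integral_finsetSum_measure]
    · simp [ENNReal.toReal_ofReal']
    · intro i _
      exact (integrable_dirac (by simp)).smul_measure ENNReal.ofReal_ne_top
  rw [(stepFun_stieltjesPair c ht).intD_eq hT hf, hint c, hint (fun i => -c i),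
    ← Finset.sum_sub_distrib]
  refine Finset.sum_congr rfl fun i _ => ?_
  rw [← sub_mul, max_zero_sub_max_neg_zero_eq_self]

lemma StieltjesPair.eVariationOn_le {T : ℝ} (hT : 0 < T) {p q : Measure ℝ} {A : ℝ → ℝ}
    (h : StieltjesPair T p q A) :
    eVariationOn A (Icc 0 T) ≤ ENNReal.ofReal (p.real univ + q.real univ) := by
  have := h.finite_left
  have := h.finite_right
  set G : ℝ → ℝ := fun t => p.real (Icc 0 t) + q.real (Icc 0 t) with hG
  have hp : Monotone fun t => p.real (Icc 0 t) := fun a b hab =>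
    measureReal_mono (Icc_subset_Icc_right hab)
  have hq : Monotone fun t => q.real (Icc 0 t) := fun a b hab =>
    measureReal_mono (Icc_subset_Icc_right hab)
  have hGm : Monotone G := hp.add hq
  have h1 : eVariationOn A (Icc 0 T) ≤ eVariationOn G (Icc 0 T) := by
    refine iSup_le fun u => ?_
    refine le_trans (Finset.sum_le_sum fun i _ => ?_)
      (eVariationOn.sum_le (n := u.1) u.2.2.1 u.2.2.2)
    have hle := u.2.2.1 (Nat.le_succ i)
    rw [edist_dist, edist_dist]
    refine ENNReal.ofReal_le_ofReal ?_
    rw [Real.dist_eq, Real.dist_eq, h.eq_sub _ (u.2.2.2 _), h.eq_sub _ (u.2.2.2 _)]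
    have e1 := hp hle
    have e2 := hq hle
    simp only at e1 e2
    refine le_trans ?_ (le_abs_self _)
    simp only [hG]
    rw [abs_le]
    constructor <;> linarith
  have h2 := MonotoneOn.eVariationOn_eq (hGm.monotoneOn (Icc 0 T)) (a := 0) (b := T)
    ⟨le_rfl, hT.le⟩ ⟨hT.le, le_rfl⟩
  rw [inter_self] at h2
  refine h1.trans (h2.le.trans (ENNReal.ofReal_le_ofReal ?_))
  have e1 : p.real (Icc 0 T) ≤ p.real univ := measureReal_mono (subset_univ _)
  have e2 : q.real (Icc 0 T) ≤ q.real univ := measureReal_mono (subset_univ _)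
  have e3 : 0 ≤ G 0 := add_nonneg measureReal_nonneg measureReal_nonneg
  simp only [hG] at e3 ⊢
  linarith

lemma stepFun_memV {m : ℕ} (c : Fin m → ℝ) {t : Fin m → ℝ} {T : ℝ} (hT : 0 < T)
    (ht : ∀ i, t i ∈ Icc 0 T) : MemV T (stepFun c t) :=
  ⟨stepFun_cadlag c t T,
    ne_top_of_le_ne_top ENNReal.ofReal_ne_top ((stepFun_stieltjesPair c ht).eVariationOn_le hT)⟩

/-- Extending a step function approximation on `[0,b)` to `[0,d)`. -/
lemma exists_stepFun_extend {x : ℝ → ℝ} {ε b d L : ℝ} (hb : 0 ≤ b) (hbd : b ≤ d)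
    (h : ∃ (m : ℕ) (c t : Fin m → ℝ), (∀ i, t i ∈ Icc 0 b) ∧
      ∀ u ∈ Ico 0 b, |x u - stepFun c t u| ≤ ε)
    (hL : ∀ u ∈ Ico b d, |x u - L| ≤ ε) :
    ∃ (m : ℕ) (c t : Fin m → ℝ), (∀ i, t i ∈ Icc 0 d) ∧
      ∀ u ∈ Ico 0 d, |x u - stepFun c t u| ≤ ε := by
  obtain ⟨m, c, t, ht, happ⟩ := h
  refine ⟨m + 1, Fin.snoc c (L - ∑ i, c i), Fin.snoc t b, ?_, fun u hu => ?_⟩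
  · refine Fin.lastCases ?_ fun i => ?_
    · simp [hb, hbd]
    · simpa using Icc_subset_Icc_right hbd (ht i)
  · rw [stepFun_snoc]
    rcases lt_or_ge u b with hub | hub
    · simpa [not_le.2 hub] using happ u ⟨hu.1, hub⟩
    · rw [stepFun_eq_sum fun i => (ht i).2.trans hub]
      simpa [hub] using hL u ⟨hub, hu.2⟩

/-- A càdlàg function is a uniform limit of step functions. -/
lemma Cadlag.exists_stepFun {T : ℝ} (hT : 0 < T) {x : ℝ → ℝ} (hx : Cadlag T x) {ε : ℝ}
    (hε : 0 < ε) :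
    ∃ (m : ℕ) (c t : Fin m → ℝ), (∀ i, t i ∈ Icc 0 T) ∧
      ∀ u ∈ Icc 0 T, |x u - stepFun c t u| ≤ ε := by
  set S : Set ℝ := {b | b ∈ Icc 0 T ∧ ∃ (m : ℕ) (c t : Fin m → ℝ), (∀ i, t i ∈ Icc 0 b) ∧
      ∀ u ∈ Ico 0 b, |x u - stepFun c t u| ≤ ε} with hS
  have h0 : (0 : ℝ) ∈ S := ⟨⟨le_rfl, hT.le⟩, 0, Fin.elim0, Fin.elim0, fun i => i.elim0,
    fun u hu => absurd hu.2 (not_lt.2 hu.1)⟩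
  have hbdd : BddAbove S := ⟨T, fun b hb => hb.1.2⟩
  set s := sSup S with hs
  have hs0 : 0 ≤ s := le_csSup hbdd h0
  have hsT : s ≤ T := csSup_le ⟨0, h0⟩ fun b hb => hb.1.2
  have hsS : s ∈ S := by
    rcases hs0.eq_or_lt with h | h
    · rwa [← h]
    · obtain ⟨L, hL⟩ := hx.2 s ⟨h, hsT⟩
      have hev := hL (Metric.closedBall_mem_nhds L hε)
      obtain ⟨l, hl, hlL⟩ := (mem_nhdsLT_iff_exists_Ioo_subset).1 hev
      obtain ⟨b, hbS, hlb⟩ := exists_lt_of_lt_csSup ⟨0, h0⟩ (mem_Iio.1 hl)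
      have hbs : b ≤ s := le_csSup hbdd hbS
      refine ⟨⟨hs0, hsT⟩, exists_stepFun_extend hbS.1.1 hbs hbS.2 (L := L) fun u hu => ?_⟩
      have := hlL ⟨hlb.trans_le hu.1, hu.2⟩
      simpa [Real.dist_eq] using this
  have hsT' : s = T := by
    by_contra hne
    have hlt : s < T := lt_of_le_of_ne hsT hne
    have hev := hx.1 s ⟨hs0, hlt⟩ (Metric.closedBall_mem_nhds (x s) hε)
    obtain ⟨r, hr, hrL⟩ := (mem_nhdsGT_iff_exists_Ioo_subset).1 hev
    have hsd : s < min r T := lt_min hr hlt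
    have : min r T ∈ S := by
      refine ⟨⟨hs0.trans hsd.le, min_le_right _ _⟩,
        exists_stepFun_extend hs0 hsd.le hsS.2 (L := x s) fun u hu => ?_⟩
      rcases hu.1.eq_or_lt with rfl | hlt
      · simpa using hε.le
      · have := hrL ⟨hlt, hu.2.trans_le (min_le_left _ _)⟩
        simpa [Real.dist_eq] using this
    exact absurd (le_csSup hbdd this) (not_le.2 hsd)
  obtain ⟨-, m, c, t, ht, happ⟩ := hsS
  rw [hsT'] at ht happ
  refine ⟨m + 1, Fin.snoc c (x T - ∑ i, c i), Fin.snoc t T, ?_, fun u hu => ?_⟩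
  · refine Fin.lastCases ?_ fun i => ?_
    · simp [hT.le]
    · simpa using ht i
  · rw [stepFun_snoc]
    rcases hu.2.lt_or_eq with huT | rfl
    · simpa [not_le.2 huT] using happ u ⟨hu.1, huT⟩
    · rw [stepFun_eq_sum fun i => (ht i).2]
      simpa using hε.le

lemma Cadlag.bddMeasOn {T : ℝ} (hT : 0 < T) {x : ℝ → ℝ} (hx : Cadlag T x) : BddMeasOn T x :=
  .of_approx fun ε hε => by
    obtain ⟨m, c, t, -, h⟩ := hx.exists_stepFun hT hε
    exact ⟨stepFun c t, stepFun_bddMeasOn c t T, h⟩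

/-- `x` has at least `n` successive `η`-oscillations on `[a,T)`. -/
def OscFrom (x : ℝ → ℝ) (η T : ℝ) : ℕ → ℝ → Prop
  | 0, _ => True
  | n + 1, a => ∃ s u, a ≤ s ∧ s < u ∧ u < T ∧ η < |x u - x s| ∧ OscFrom x η T n u

/-- If `x` has fewer than `n` oscillations then it is approximated by a step function with a
number and size of jumps depending only on `n` and a bound of `x`. -/
lemma Cadlag.exists_stepFun_of_not_oscFrom {T K η : ℝ} {x : ℝ → ℝ} (hx : Cadlag T x)
    (hη : 0 ≤ η) (hK : ∀ t ∈ Icc 0 T, |x t| ≤ K) (n : ℕ) :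
    ∀ a ∈ Ico 0 T, ¬ OscFrom x η T n a → ∃ c t : Fin (2 * n) → ℝ, (∀ i, |c i| ≤ K) ∧
      (∀ i, t i ∈ Icc a T) ∧ ∀ u ∈ Ico a T, |x u - stepFun c t u| ≤ η := by
  induction n with
  | zero => exact fun a _ h => absurd trivial h
  | succ n ih =>
    intro a ha hosc
    have hxa : |x a| ≤ K := hK a ⟨ha.1, ha.2.le⟩
    set S : Set ℝ := {t | t ∈ Ico a T ∧ η < |x t - x a|} with hS
    rcases S.eq_empty_or_nonempty with hemp | hne
    · refine ⟨(Fin.cons (x a) fun _ => 0 : Fin (2 * n + 1 + 1) → ℝ), fun _ => a, ?_,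
        fun _ => ⟨le_rfl, ha.2.le⟩, fun u hu => ?_⟩
      · refine Fin.cases (by simpa using hxa) fun i => ?_
        simpa using (abs_nonneg _).trans hxa
      · rw [stepFun_eq_sum fun _ => hu.1]
        have h1 : ∑ i, (Fin.cons (x a) (fun _ => 0) : Fin (2 * n + 1 + 1) → ℝ) i = x a := by
          simp [Fin.sum_univ_succ]
        have h2 : ¬ η < |x u - x a| := fun h => by
          have : u ∈ S := ⟨hu, h⟩
          simp [hemp] at this
        rw [not_lt] at h2
        exact le_of_eq_of_le (congrArg (fun z => |x u - z|) h1) h2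
    · set b := sInf S with hb
      have hbdd : BddBelow S := ⟨a, fun t ht => ht.1.1⟩
      have hab : a ≤ b := le_csInf hne fun t ht => ht.1.1
      have hbT : b < T := by
        obtain ⟨t, ht⟩ := hne
        exact (csInf_le hbdd ht).trans_lt ht.1.2
      have hSa : ∀ t ∈ S, a < t := fun t ht => by
        refine lt_of_le_of_ne ht.1.1 ?_
        rintro rfl
        have := ht.2
        simp at this
        linarith
      have hb_osc : ¬ OscFrom x η T n b := by
        intro h
        apply hosc
        cases n with
        | zero =>
          obtain ⟨t, ht⟩ := hne
          exact ⟨a, t, le_rfl, hSa t ht, ht.1.2, ht.2, trivial⟩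
        | succ k =>
          obtain ⟨s, u, hbs, hsu, huT, hlt, hrest⟩ := h
          have hright := hx.1 s ⟨ha.1.trans (hab.trans hbs), hsu.trans huT⟩
          have hev : ∀ᶠ s' in 𝓝[>] s, η < |x u - x s'| :=
            ((tendsto_const_nhds.sub hright).abs).eventually (lt_mem_nhds hlt)
          obtain ⟨s', hs', hss', hs'u⟩ := (hev.and (Ioo_mem_nhdsGT hsu)).exists
          obtain ⟨t, ht, hts'⟩ := exists_lt_of_csInf_lt hne (hbs.trans_lt hss')
          exact ⟨a, t, le_rfl, hSa t ht, ht.1.2, ht.2, s', u, hts'.le, hs'u, huT, hs', hrest⟩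
      obtain ⟨c, t, hc, ht, happ⟩ := ih b ⟨ha.1.trans hab, hbT⟩ hb_osc
      refine ⟨(Fin.cons (x a) (Fin.cons (-x a) c : Fin (2 * n + 1) → ℝ) : Fin (2 * n + 1 + 1) → ℝ),
        (Fin.cons a (Fin.cons b t : Fin (2 * n + 1) → ℝ) : Fin (2 * n + 1 + 1) → ℝ), ?_, ?_,
        fun u hu => ?_⟩
      · refine Fin.cases (by simpa using hxa) (Fin.cases (by simpa using hxa) fun i => ?_)
        simpa using hc i
      · refine Fin.cases ?_ (Fin.cases ?_ fun i => ?_)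
        · simpa using ha.2.le
        · simpa using ⟨hab, hbT.le⟩
        · simpa using Icc_subset_Icc_left hab (ht i)
      · have hstep : stepFun
            (Fin.cons (x a) (Fin.cons (-x a) c : Fin (2 * n + 1) → ℝ) : Fin (2 * n + 1 + 1) → ℝ)
            (Fin.cons a (Fin.cons b t : Fin (2 * n + 1) → ℝ) : Fin (2 * n + 1 + 1) → ℝ) u =
            x a + ((if b ≤ u then -x a else 0) + stepFun c t u) := by
          rw [stepFun_cons, stepFun_cons, if_pos hu.1]
        refine le_of_eq_of_le (congrArg (fun z => |x u - z|) hstep) ?_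
        rcases lt_or_ge u b with hub | hub
        · rw [stepFun_eq_zero fun i => hub.trans_le (ht i).1, if_neg (not_le.2 hub)]
          have : u ∉ S := notMem_of_lt_csInf hub hbdd
          simp only [hS, mem_ofPred_eq, not_and, not_lt] at this
          simpa using this hu
        · simpa [hub] using happ u ⟨hub, hu.2⟩

/-- The closed-interval version of the uniform step function approximation. -/
lemma Cadlag.exists_stepFun_Icc_of_not_oscFrom {T K η : ℝ} (hT : 0 < T) {x : ℝ → ℝ}
    (hx : Cadlag T x) (hη : 0 ≤ η) (hK : ∀ t ∈ Icc 0 T, |x t| ≤ K) {n : ℕ}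
    (h : ¬ OscFrom x η T n 0) :
    ∃ c t : Fin (2 * n + 1) → ℝ, (∀ i, |c i| ≤ K + 2 * n * K) ∧ (∀ i, t i ∈ Icc 0 T) ∧
      ∀ u ∈ Icc 0 T, |x u - stepFun c t u| ≤ η := by
  obtain ⟨c, t, hc, ht, happ⟩ := hx.exists_stepFun_of_not_oscFrom hη hK n 0 ⟨le_rfl, hT⟩ h
  have hTT : T ∈ Icc 0 T := ⟨hT.le, le_rfl⟩
  have hK0 : 0 ≤ K := (abs_nonneg _).trans (hK T hTT)
  refine ⟨Fin.snoc c (x T - ∑ i, c i), Fin.snoc t T, ?_, ?_, fun u hu => ?_⟩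
  · refine Fin.lastCases ?_ fun i => ?_
    · have h1 : |∑ i, c i| ≤ 2 * n * K := by
        refine (Finset.abs_sum_le_sum_abs _ _).trans
          ((Finset.sum_le_sum fun i _ => hc i).trans ?_)
        simp
      simpa using (abs_sub _ _).trans (add_le_add (hK T hTT) h1)
    · have : 0 ≤ 2 * n * K := by positivity
      simpa using (hc i).trans (by linarith)
  · refine Fin.lastCases ?_ fun i => ?_
    · simp [hT.le]
    · simpa using ht i
  · rw [stepFun_snoc]
    rcases hu.2.lt_or_eq with huT | rfl
    · simpa [not_le.2 huT] using happ u ⟨hu.1, huT⟩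
    · rw [stepFun_eq_sum fun i => (ht i).2]
      simpa using hη

/-- The continuous function increasing linearly from `0` to `1` on `[a, a + h]`. -/
def ramp (a h t : ℝ) : ℝ := max 0 (min 1 ((t - a) / h))

lemma ramp_nonneg (a h t : ℝ) : 0 ≤ ramp a h t := le_max_left _ _

lemma ramp_le_one (a h t : ℝ) : ramp a h t ≤ 1 := max_le zero_le_one (min_le_left _ _)

lemma continuous_ramp (a h : ℝ) : Continuous (ramp a h) := by
  unfold ramp
  fun_prop

lemma ramp_anti {a b h : ℝ} (hh : 0 < h) (hab : a ≤ b) (t : ℝ) : ramp b h t ≤ ramp a h t := by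
  unfold ramp
  gcongr

lemma ramp_zero {a h : ℝ} (hh : 0 < h) (ha : 0 ≤ a) : ramp a h 0 = 0 := by
  refine max_eq_left ((min_le_right _ _).trans ?_)
  exact div_nonpos_of_nonpos_of_nonneg (by linarith) hh.le

/-- The uniform probability measure on `(a, a + h]`. -/
def unifMeasure (a h : ℝ) : Measure ℝ := ENNReal.ofReal h⁻¹ • volume.restrict (Ioc a (a + h))

instance (a h : ℝ) : IsFiniteMeasure (unifMeasure a h) :=
  ⟨by simp [unifMeasure, ENNReal.mul_lt_top]⟩

lemma ae_mem_unifMeasure (a h : ℝ) : ∀ᵐ t ∂unifMeasure a h, t ∈ Ioc a (a + h) := by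
  refine Measure.ae_smul_measure ?_ _
  exact ae_restrict_mem measurableSet_Ioc

lemma unifMeasure_univ {a h : ℝ} (hh : 0 < h) : (unifMeasure a h).real univ = 1 := by
  simp [unifMeasure, measureReal_def, hh.le, hh.ne']

lemma unifMeasure_support {a h T : ℝ} (ha : 0 ≤ a) (hT : a + h ≤ T) :
    unifMeasure a h (Icc 0 T)ᶜ = 0 := by
  have : ∀ᵐ t ∂unifMeasure a h, t ∈ Icc 0 T := by
    filter_upwards [ae_mem_unifMeasure a h] with t ht
    exact ⟨ha.trans ht.1.le, ht.2.trans hT⟩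
  exact ae_iff.1 this

lemma unifMeasure_Icc {a h t : ℝ} (hh : 0 < h) (ha : 0 ≤ a) :
    (unifMeasure a h).real (Icc 0 t) = ramp a h t := by
  have h1 : Icc 0 t ∩ Ioc a (a + h) = Ioc a (min t (a + h)) := by
    ext s
    simp only [mem_inter_iff, mem_Icc, mem_Ioc, le_min_iff]
    grind
  rw [unifMeasure, measureReal_def, Measure.smul_apply, Measure.restrict_apply measurableSet_Icc,
    h1, Real.volume_Ioc, smul_eq_mul, ENNReal.toReal_mul, ENNReal.toReal_ofReal (by positivity),
    ENNReal.toReal_ofReal', ramp, max_comm, mul_max_of_nonneg _ _ (by positivity), mul_zero,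
    ← min_sub_sub_right, mul_min_of_nonneg _ _ (by positivity), min_comm]
  congr 2
  · field_simp; ring
  · rw [div_eq_inv_mul]

lemma Cadlag.eventually_integral_unifMeasure {T : ℝ} (hT : 0 < T) {x : ℝ → ℝ} (hx : Cadlag T x)
    {a : ℝ} (ha : a ∈ Ico 0 T) {δ : ℝ} (hδ : 0 < δ) :
    ∀ᶠ h in 𝓝[>] (0 : ℝ), |∫ t, x t ∂unifMeasure a h - x a| ≤ δ := by
  obtain ⟨r, hr, hrx⟩ := (mem_nhdsGT_iff_exists_Ioo_subset).1
    (hx.1 a ha (Metric.closedBall_mem_nhds (x a) hδ))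
  have hr' : (0 : ℝ) < min (r - a) (T - a) := lt_min (sub_pos.2 hr) (sub_pos.2 ha.2)
  filter_upwards [Ioo_mem_nhdsGT hr'] with h hh
  have h1 : a + h < r := by linarith [hh.2.trans_le (min_le_left _ _)]
  have h2 : a + h ≤ T := by linarith [hh.2.trans_le (min_le_right _ _)]
  have hint := (hx.bddMeasOn hT).integrable (unifMeasure_support ha.1 h2)
  have h3 : ∫ t, x t ∂unifMeasure a h - x a = ∫ t, (x t - x a) ∂unifMeasure a h := by
    rw [integral_sub hint (integrable_const _), integral_const, unifMeasure_univ hh.1, one_smul]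
  rw [h3, ← Real.norm_eq_abs]
  refine (norm_integral_le_of_norm_le_const (C := δ) ?_).trans ?_
  · filter_upwards [ae_mem_unifMeasure a h] with t ht
    have := hrx ⟨ht.1, ht.2.trans_lt h1⟩
    simpa [Real.dist_eq] using this
  · rw [unifMeasure_univ hh.1, mul_one]

lemma StieltjesPair.smul {T : ℝ} {p q : Measure ℝ} {A : ℝ → ℝ} (h : StieltjesPair T p q A)
    {r : ℝ} (hr : 0 ≤ r) :
    StieltjesPair T (ENNReal.ofReal r • p) (ENNReal.ofReal r • q) (fun t => r * A t) := by
  have := h.finite_left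
  have := h.finite_right
  refine ⟨p.smul_finite ENNReal.ofReal_ne_top, q.smul_finite ENNReal.ofReal_ne_top, ?_, ?_,
    fun t ht => ?_⟩
  · simp [h.support_left]
  · simp [h.support_right]
  · simp [h.eq_sub t ht, hr]
    ring

lemma StieltjesPair.add {T : ℝ} {p q p' q' : Measure ℝ} {A B : ℝ → ℝ}
    (h : StieltjesPair T p q A) (h' : StieltjesPair T p' q' B) :
    StieltjesPair T (p + p') (q + q') (fun t => A t + B t) := by
  have := h.finite_left
  have := h.finite_right
  have := h'.finite_left
  have := h'.finite_right
  refine ⟨inferInstance, inferInstance, ?_, ?_, fun t ht => ?_⟩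
  · simp [h.support_left, h'.support_left]
  · simp [h.support_right, h'.support_right]
  · rw [measureReal_add_apply, measureReal_add_apply, h.eq_sub t ht, h'.eq_sub t ht]
    ring

lemma stieltjesPair_ramp_sub {T a b h : ℝ} (hh : 0 < h) (ha : 0 ≤ a) (hb : 0 ≤ b)
    (haT : a + h ≤ T) (hbT : b + h ≤ T) :
    StieltjesPair T (unifMeasure a h) (unifMeasure b h) (fun t => ramp a h t - ramp b h t) :=
  ⟨inferInstance, inferInstance, unifMeasure_support ha haT, unifMeasure_support hb hbT,
    fun t _ => by rw [unifMeasure_Icc hh ha, unifMeasure_Icc hh hb]⟩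

lemma stieltjesPair_ramp {T a h : ℝ} (hh : 0 < h) (ha : 0 ≤ a) (haT : a + h ≤ T) :
    StieltjesPair T (unifMeasure a h) 0 (ramp a h) :=
  ⟨inferInstance, inferInstance, unifMeasure_support ha haT, by simp,
    fun t _ => by rw [unifMeasure_Icc hh ha]; simp⟩

/-- Oscillations of `x` are detected by an integrator of small size. -/
lemma Cadlag.eventually_exists_test_of_oscFrom {T : ℝ} (hT : 0 < T) {x : ℝ → ℝ}
    (hx : Cadlag T x) {η : ℝ} (hη : 0 < η) (n : ℕ) :
    ∀ a, 0 ≤ a → OscFrom x η T n a → ∀ᶠ h in 𝓝[>] (0 : ℝ), ∃ (p q : Measure ℝ) (A : ℝ → ℝ),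
      StieltjesPair T p q A ∧ Continuous A ∧ (∀ t, |A t| ≤ ramp a h t) ∧
      p.real univ ≤ n ∧ q.real univ ≤ n ∧ n * (η / 2) ≤ ∫ t, x t ∂p - ∫ t, x t ∂q := by
  have hxm := hx.bddMeasOn hT
  induction n with
  | zero =>
    intro a _ _
    refine Eventually.of_forall fun h => ⟨0, 0, fun _ => 0, ⟨inferInstance, inferInstance,
      by simp, by simp, by simp⟩, continuous_const, fun t => ?_, by simp, by simp, by simp⟩
    simpa using ramp_nonneg a h t
  | succ n ih =>
    rintro a ha ⟨s, u, has, hsu, huT, hosc, hrest⟩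
    have hs0 : 0 ≤ s := ha.trans has
    have hu0 : 0 ≤ u := hs0.trans hsu.le
    filter_upwards [ih u hu0 hrest, Ioo_mem_nhdsGT (sub_pos.2 huT),
      hx.eventually_integral_unifMeasure hT ⟨hs0, hsu.trans huT⟩ (show 0 < η / 4 by positivity),
      hx.eventually_integral_unifMeasure hT ⟨hu0, huT⟩ (show 0 < η / 4 by positivity)]
      with h ⟨p, q, A, hA, hAc, hAb, hp, hq, hint⟩ hh hes heu
    have := hA.finite_left
    have := hA.finite_right
    have huh : u + h ≤ T := by linarith [hh.2]
    have hsh : s + h ≤ T := by linarith [hh.2]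
    have ips := hxm.integrable hA.support_left
    have iqs := hxm.integrable hA.support_right
    have ius := hxm.integrable (unifMeasure_support hu0 huh)
    have iss := hxm.integrable (unifMeasure_support hs0 hsh)
    rw [abs_le] at hes heu
    push_cast
    have bound : ∀ t B, B ≤ ramp s h t - ramp u h t → -(ramp s h t - ramp u h t) ≤ B →
        |A t + B| ≤ ramp a h t := by
      intro t B h1 h2
      have h3 := abs_le.1 (hAb t)
      have h4 := ramp_anti hh.1 has t
      rw [abs_le]
      constructor <;> linarith
    rcases lt_abs.1 hosc with hpos | hneg
    · refine ⟨_, _, _, hA.add (stieltjesPair_ramp_sub hh.1 hu0 hs0 huh hsh),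
        hAc.add ((continuous_ramp _ _).sub (continuous_ramp _ _)), fun t => bound t _ ?_ ?_,
        ?_, ?_, ?_⟩
      · linarith [ramp_anti hh.1 hsu.le t]
      · linarith
      · rw [measureReal_add_apply, unifMeasure_univ hh.1]; linarith
      · rw [measureReal_add_apply, unifMeasure_univ hh.1]; linarith
      · rw [integral_add_measure ips ius, integral_add_measure iqs iss]
        linarith
    · refine ⟨_, _, _, hA.add (stieltjesPair_ramp_sub hh.1 hs0 hu0 hsh huh),
        hAc.add ((continuous_ramp _ _).sub (continuous_ramp _ _)), fun t => bound t _ ?_ ?_,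
        ?_, ?_, ?_⟩
      · linarith
      · linarith [ramp_anti hh.1 hsu.le t]
      · rw [measureReal_add_apply, unifMeasure_univ hh.1]; linarith
      · rw [measureReal_add_apply, unifMeasure_univ hh.1]; linarith
      · rw [integral_add_measure ips iss, integral_add_measure iqs ius]
        linarith

lemma StieltjesPair.memA {T : ℝ} (hT : 0 < T) {p q : Measure ℝ} {A : ℝ → ℝ}
    (h : StieltjesPair T p q A) (hA : Continuous A) (h0 : A 0 = 0) : MemA T A :=
  ⟨hA.continuousOn, ne_top_of_le_ne_top ENNReal.ofReal_ne_top (h.eVariationOn_le hT), h0⟩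

lemma StieltjesPair.intD_smul {T : ℝ} (hT : 0 < T) {p q : Measure ℝ} {A f : ℝ → ℝ}
    (h : StieltjesPair T p q A) (hf : BddMeasOn T f) {r : ℝ} (hr : 0 ≤ r) :
    intD T f (fun t => r * A t) = r * (∫ t, f t ∂p - ∫ t, f t ∂q) := by
  rw [(h.smul hr).intD_eq hT hf, integral_smul_measure, integral_smul_measure,
    ENNReal.toReal_ofReal hr, smul_eq_mul, smul_eq_mul]
  ring

/-- `A` is an integrator of size at most `δ` and variation at most `2`, against which the integral
of `x` is at least `θ` in absolute value. -/
def IsTest (T δ θ : ℝ) (x A : ℝ → ℝ) : Prop :=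
  MemA T A ∧ (∀ t ∈ Icc 0 T, |A t| ≤ δ) ∧ θ ≤ |intD T x A| ∧
    ∃ p q : Measure ℝ, StieltjesPair T p q A ∧ p.real univ + q.real univ ≤ 2

lemma Cadlag.exists_isTest_of_oscFrom {T : ℝ} (hT : 0 < T) {x : ℝ → ℝ}
    (hx : Cadlag T x) {η : ℝ} (hη : 0 < η) {n : ℕ} (h : OscFrom x η T (n + 1) 0) :
    ∃ A, IsTest T (1 / ((n : ℝ) + 1)) (η / 2) x A := by
  obtain ⟨k, ⟨p, q, A, hA, hAc, hAb, hp, hq, hint⟩, hk⟩ :=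
    ((hx.eventually_exists_test_of_oscFrom hT hη (n + 1) 0 le_rfl h).and
      self_mem_nhdsWithin).exists
  have hk : 0 < k := hk
  push_cast at hp hq hint
  have hn : (0 : ℝ) < (n : ℝ) + 1 := by positivity
  have hr : (0 : ℝ) ≤ 1 / ((n : ℝ) + 1) := by positivity
  have hA0 : A 0 = 0 := by
    have := hAb 0
    rw [ramp_zero hk le_rfl] at this
    exact abs_nonpos_iff.1 this
  refine ⟨fun t => 1 / ((n : ℝ) + 1) * A t, (hA.smul hr).memA hT (continuous_const.mul hAc)
    (by simp [hA0]), fun t _ => ?_, ?_, _, _, hA.smul hr, ?_⟩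
  · rw [abs_mul, abs_of_nonneg hr]
    exact mul_le_of_le_one_right hr ((hAb t).trans (ramp_le_one _ _ _))
  · rw [hA.intD_smul hT (hx.bddMeasOn hT) hr]
    refine le_trans ?_ (le_abs_self _)
    rw [one_div, ← div_eq_inv_mul, le_div_iff₀ hn]
    linarith
  · rw [measureReal_ennreal_smul_apply, measureReal_ennreal_smul_apply, ENNReal.toReal_ofReal hr,
      ← mul_add, one_div, ← div_eq_inv_mul, div_le_iff₀ hn]
    linarith

lemma Cadlag.exists_isTest_of_large {T : ℝ} (hT : 0 < T) {x : ℝ → ℝ} (hx : Cadlag T x)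
    {n : ℕ} {s : ℝ} (hs : s ∈ Ico 0 T) (h : 2 * ((n : ℝ) + 1) < |x s|) :
    ∃ A, IsTest T (1 / ((n : ℝ) + 1)) 1 x A := by
  have hn : (0 : ℝ) < (n : ℝ) + 1 := by positivity
  have hr : (0 : ℝ) ≤ 1 / ((n : ℝ) + 1) := by positivity
  obtain ⟨k, hk1, hk⟩ := ((hx.eventually_integral_unifMeasure hT hs hn).and
    (Ioo_mem_nhdsGT (sub_pos.2 hs.2))).exists
  have hA := stieltjesPair_ramp hk.1 hs.1 (show s + k ≤ T by linarith [hk.2])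
  refine ⟨fun t => 1 / ((n : ℝ) + 1) * ramp s k t, (hA.smul hr).memA hT
    (continuous_const.mul (continuous_ramp _ _)) (by simp [ramp_zero hk.1 hs.1]),
    fun t _ => ?_, ?_, _, _, hA.smul hr, ?_⟩
  · rw [abs_mul, abs_of_nonneg hr, abs_of_nonneg (ramp_nonneg _ _ _)]
    exact mul_le_of_le_one_right hr (ramp_le_one _ _ _)
  · rw [hA.intD_smul hT (hx.bddMeasOn hT) hr, integral_zero_measure, sub_zero, abs_mul,
      abs_of_nonneg hr, one_div, ← div_eq_inv_mul, le_div_iff₀ hn]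
    have h1 := abs_sub_abs_le_abs_sub (x s) (∫ t, x t ∂unifMeasure s k)
    rw [abs_sub_comm] at h1
    linarith
  · rw [smul_zero, measureReal_zero_apply, measureReal_ennreal_smul_apply,
      ENNReal.toReal_ofReal hr, unifMeasure_univ hk.1, one_div, mul_one, add_zero]
    have : ((n : ℝ) + 1)⁻¹ ≤ 1 := inv_le_one_of_one_le₀ (by linarith [(n.cast_nonneg : (0:ℝ) ≤ n)])
    linarith

/-- Convergence of sequences in the topology `Σ`. -/
def SigmaConv (T : ℝ) (x : ℕ → ℝ → ℝ) (x₀ : ℝ → ℝ) : Prop :=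
  Tendsto (fun n => x n T) atTop (𝓝 (x₀ T)) ∧
    ∀ 𝒜 : Set (ℝ → ℝ), (∀ A ∈ 𝒜, MemA T A) → RelTauCompact T 𝒜 →
      ∀ δ > (0:ℝ), ∃ N : ℕ, ∀ n ≥ N, ∀ A ∈ 𝒜, |intD T (fun u => x n u - x₀ u) A| ≤ δ

lemma TauConv.comp {T : ℝ} {A : ℕ → ℝ → ℝ} {A₀ : ℝ → ℝ} (h : TauConv T A A₀) {j : ℕ → ℕ}
    (hj : Tendsto j atTop atTop) : TauConv T (fun n => A (j n)) A₀ :=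
  ⟨fun u hu => hj.eventually (h.1 u hu), h.2.imp fun _ hM n => hM (j n)⟩

lemma MemA.tauConv_const {T : ℝ} {A : ℝ → ℝ} (hA : MemA T A) : TauConv T (fun _ => A) A :=
  ⟨fun _ hu => Eventually.of_forall fun _ _ _ => refl_mem_uniformity hu,
    (eVariationOn A (Icc 0 T)).toReal, fun _ => (ENNReal.ofReal_toReal hA.2.1).ge⟩

lemma TauConv.relTauCompact_range {T : ℝ} {A : ℕ → ℝ → ℝ} {A₀ : ℝ → ℝ} (h : TauConv T A A₀)
    (hA : ∀ n, MemA T (A n)) (hA₀ : MemA T A₀) : RelTauCompact T (range A) := by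
  intro B hB
  choose j hj using hB
  obtain rfl : (fun n => A (j n)) = B := funext hj
  by_cases hc : ∃ c, ∃ᶠ n in atTop, j n = c
  · obtain ⟨c, hc⟩ := hc
    obtain ⟨φ, hφ, hφc⟩ := extraction_of_frequently_atTop hc
    exact ⟨φ, hφ, A c, hA c, by simpa [hφc] using (hA c).tauConv_const⟩
  · refine ⟨id, strictMono_id, A₀, hA₀, h.comp ?_⟩
    push Not at hc
    rw [← Nat.cofinite_eq_atTop]
    refine fun s hs => ?_
    rw [mem_cofinite] at hs
    rw [Filter.mem_map, Nat.cofinite_eq_atTop]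
    filter_upwards [(eventually_all_finite hs).2 fun c _ => hc c] with n hn
    by_contra hns
    exact hn _ hns rfl

lemma MemA.relTauCompact_singleton {T : ℝ} {A : ℝ → ℝ} (hA : MemA T A) :
    RelTauCompact T {A} := by
  simpa using hA.tauConv_const.relTauCompact_range (fun _ => hA) hA

lemma MemA.exists_stieltjesPair {T : ℝ} (hT : 0 < T) {A : ℝ → ℝ} (hA : MemA T A) :
    ∃ p q : Measure ℝ, StieltjesPair T p q A ∧
      p.real univ + q.real univ ≤ 3 * (eVariationOn A (Icc 0 T)).toReal := by
  have hr : ∀ t ∈ Ico 0 T, Tendsto A (𝓝[>] t) (𝓝 (A t)) := fun t ht =>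
    ((hA.1 t ⟨ht.1, ht.2.le⟩).mono_of_mem_nhdsWithin
      (mem_of_superset (Ioc_mem_nhdsGT ht.2) fun _ hu => ⟨ht.1.trans hu.1.le, hu.2⟩))
  simpa [hA.2.2] using _root_.exists_stieltjesPair hT hr hA.2.1

lemma MemA.intD_stepFun_left {T : ℝ} (hT : 0 < T) {A : ℝ → ℝ} (hA : MemA T A) {m : ℕ}
    (c : Fin m → ℝ) {t : Fin m → ℝ} (ht : ∀ i, t i ∈ Icc 0 T) :
    intD T (stepFun c t) A = ∑ i, c i * (A T - A (t i)) := by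
  obtain ⟨p, q, h, -⟩ := hA.exists_stieltjesPair hT
  have hm : BddMeasOn T (fun s => A T - A s) := .of_continuousOn (continuousOn_const.sub hA.1)
  rw [(stepFun_stieltjesPair c ht).intD_by_parts hT (stepFun_bddMeasOn c t T) h hA.1 hA.2.2,
    intD_stepFun c hT ht hm]

/-- Integrators of small size and bounded variation integrate a fixed càdlàg function to a small
number. -/
lemma Cadlag.tendsto_intD_of_small {T : ℝ} (hT : 0 < T) {x : ℝ → ℝ} (hx : Cadlag T x)
    {A : ℕ → ℝ → ℝ} (hA : ∀ k, MemA T (A k))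
    (hb : ∀ k : ℕ, ∀ t ∈ Icc 0 T, |A k t| ≤ 1 / ((k : ℝ) + 1))
    (hpq : ∀ k, ∃ p q : Measure ℝ, StieltjesPair T p q (A k) ∧ p.real univ + q.real univ ≤ 2) :
    Tendsto (fun k => intD T x (A k)) atTop (𝓝 0) := by
  have hA0 : ∀ t ∈ Icc 0 T, Tendsto (fun k => A k t) atTop (𝓝 0) := fun t ht =>
    squeeze_zero_norm (fun k => hb k t ht) tendsto_one_div_add_atTop_nhds_zero_nat
  rw [Metric.tendsto_atTop']
  intro ε hε
  obtain ⟨m, c, t, ht, happ⟩ := hx.exists_stepFun hT (show 0 < ε / 4 by positivity)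
  have hstep : Tendsto (fun k => intD T (stepFun c t) (A k)) atTop (𝓝 0) := by
    simp_rw [fun k => (hA k).intD_stepFun_left hT c ht]
    have := tendsto_finsetSum Finset.univ fun i (_ : i ∈ Finset.univ) =>
      ((hA0 T ⟨hT.le, le_rfl⟩).sub (hA0 (t i) (ht i))).const_mul (c i)
    simpa using this
  obtain ⟨N, hN⟩ := (Metric.tendsto_atTop'.1 hstep) (ε / 2) (by positivity)
  refine ⟨N, fun k hk => ?_⟩
  have h2 := hN k hk
  obtain ⟨p, q, h, hm⟩ := hpq k
  have hxm := hx.bddMeasOn hT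
  have h3 := h.abs_intD_le hT (hxm.sub (stepFun_bddMeasOn c t T)) happ
  rw [h.intD_sub hT hxm (stepFun_bddMeasOn c t T)] at h3
  rw [Real.dist_eq, sub_zero] at h2 ⊢
  have h4 : ε / 4 * (p.real univ + q.real univ) ≤ ε / 4 * 2 := by gcongr
  have h5 := abs_sub_abs_le_abs_sub (intD T x (A k)) (intD T (stepFun c t) (A k))
  linarith

lemma SigmaConv.not_isTest {T : ℝ} (hT : 0 < T) {x : ℕ → ℝ → ℝ} {x₀ : ℝ → ℝ}
    (hx : ∀ n, Cadlag T (x n)) (hx₀ : Cadlag T x₀) (h : SigmaConv T x x₀) {θ : ℝ} (hθ : 0 < θ) :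
    ∃ k : ℕ, ∀ n ≥ k, ∀ A, ¬ IsTest T (1 / ((k : ℝ) + 1)) θ (x n) A := by
  by_contra! hcon
  choose n hn A hA using hcon
  have hmem : ∀ k, MemA T (A k) := fun k => (hA k).1
  have h0 : MemA T (fun _ => 0) :=
    ⟨continuousOn_const, (eVariationOn.constant_on
      (subsingleton_singleton.anti (image_subset_iff.2 fun _ _ => rfl))).trans_ne
      ENNReal.zero_ne_top, rfl⟩
  have htau : TauConv T A (fun _ => 0) := by
    refine ⟨?_, 2, fun k => ?_⟩
    · rw [Metric.tendstoUniformlyOn_iff]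
      intro ε hε
      filter_upwards [(tendsto_one_div_add_atTop_nhds_zero_nat (𝕜 := ℝ)).eventually_lt_const hε]
        with k hk t ht
      rw [dist_comm, Real.dist_eq, sub_zero]
      exact ((hA k).2.1 t ht).trans_lt hk
    · obtain ⟨p, q, hpq, hm⟩ := (hA k).2.2.2
      exact (hpq.eVariationOn_le hT).trans (ENNReal.ofReal_le_ofReal hm)
  obtain ⟨N, hN⟩ := h.2 (range A) (by rintro _ ⟨k, rfl⟩; exact hmem k)
    (htau.relTauCompact_range hmem h0) (θ / 4) (by positivity)
  have hlim := hx₀.tendsto_intD_of_small hT hmem (fun k => (hA k).2.1) (fun k => (hA k).2.2.2)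
  obtain ⟨k, hk, hkN⟩ := ((hlim.abs.eventually_lt_const
    (show |(0 : ℝ)| < θ / 4 by rw [abs_zero]; positivity)).and (eventually_ge_atTop N)).exists
  have h1 := hN (n k) (hkN.trans (hn k)) (A k) ⟨k, rfl⟩
  obtain ⟨-, -, h2, p, q, hpq, -⟩ := hA k
  rw [hpq.intD_sub hT ((hx _).bddMeasOn hT) (hx₀.bddMeasOn hT)] at h1
  have h3 := abs_sub_abs_le_abs_sub (intD T (x (n k)) (A k)) (intD T x₀ (A k))
  linarith

lemma SigmaConv.exists_bound {T : ℝ} (hT : 0 < T) {x : ℕ → ℝ → ℝ} {x₀ : ℝ → ℝ}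
    (hx : ∀ n, Cadlag T (x n)) (hx₀ : Cadlag T x₀) (h : SigmaConv T x x₀) :
    ∃ (K : ℝ) (N : ℕ), 0 ≤ K ∧ ∀ n ≥ N, ∀ t ∈ Icc 0 T, |x n t| ≤ K := by
  obtain ⟨k, hk⟩ := h.not_isTest hT hx hx₀ one_pos
  obtain ⟨N, hN⟩ := eventually_atTop.1 (h.1.abs.eventually_lt_const (lt_add_one |x₀ T|))
  have hK : 0 ≤ 2 * ((k : ℝ) + 1) := by positivity
  refine ⟨2 * ((k : ℝ) + 1) + (|x₀ T| + 1), max k N, by positivity, fun n hn t ht => ?_⟩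
  rcases ht.2.lt_or_eq with htT | rfl
  · by_contra! hlt
    obtain ⟨A, hA⟩ := (hx n).exists_isTest_of_large hT ⟨ht.1, htT⟩
      (show 2 * ((k : ℝ) + 1) < |x n t| by linarith [abs_nonneg (x₀ T)])
    exact hk n (le_of_max_le_left hn) A hA
  · linarith [hN n (le_of_max_le_right hn)]

lemma SigmaConv.exists_not_oscFrom {T : ℝ} (hT : 0 < T) {x : ℕ → ℝ → ℝ} {x₀ : ℝ → ℝ}
    (hx : ∀ n, Cadlag T (x n)) (hx₀ : Cadlag T x₀) (h : SigmaConv T x x₀) {η : ℝ} (hη : 0 < η) :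
    ∃ m N : ℕ, ∀ n ≥ N, ¬ OscFrom (x n) η T m 0 := by
  obtain ⟨k, hk⟩ := h.not_isTest hT hx hx₀ (half_pos hη)
  refine ⟨k + 1, k, fun n hn hosc => ?_⟩
  obtain ⟨A, hA⟩ := (hx n).exists_isTest_of_oscFrom hT hη hosc
  exact hk n hn A hA

/-- Along a `Σ`-convergent sequence, uniform approximation by step functions with a fixed number
of jumps of bounded size. -/
lemma SigmaConv.exists_stepFun {T : ℝ} (hT : 0 < T) {x : ℕ → ℝ → ℝ} {x₀ : ℝ → ℝ}
    (hx : ∀ n, Cadlag T (x n)) (hx₀ : Cadlag T x₀) (h : SigmaConv T x x₀) {ε : ℝ} (hε : 0 < ε) :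
    ∃ (m N : ℕ) (R : ℝ) (c t : ℕ → Fin m → ℝ), ∀ n, c n ∈ Metric.closedBall 0 R ∧
      (∀ i, t n i ∈ Icc 0 T) ∧ (N ≤ n → ∀ u ∈ Icc 0 T, |x n u - stepFun (c n) (t n) u| ≤ ε) := by
  obtain ⟨K, N, hK0, hK⟩ := h.exists_bound hT hx hx₀
  obtain ⟨m, N', hm⟩ := h.exists_not_oscFrom hT hx hx₀ hε
  have key : ∀ n, ∃ ct : (Fin (2 * m + 1) → ℝ) × (Fin (2 * m + 1) → ℝ),
      ct.1 ∈ Metric.closedBall 0 (K + 2 * m * K) ∧ (∀ i, ct.2 i ∈ Icc 0 T) ∧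
      (max N N' ≤ n → ∀ u ∈ Icc 0 T, |x n u - stepFun ct.1 ct.2 u| ≤ ε) := fun n => by
    have hR : 0 ≤ K + 2 * m * K := by positivity
    by_cases hn : max N N' ≤ n
    · obtain ⟨c, t, hc, ht, happ⟩ := (hx n).exists_stepFun_Icc_of_not_oscFrom hT hε.le
        (hK n (le_of_max_le_left hn)) (hm n (le_of_max_le_right hn))
      exact ⟨(c, t), by simpa [pi_norm_le_iff_of_nonneg hR] using hc, ht, fun _ => happ⟩
    · exact ⟨(0, 0), by simpa using hR, fun _ => ⟨le_rfl, hT.le⟩, fun h => absurd h hn⟩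
  choose ct hct using key
  exact ⟨_, _, _, fun n => (ct n).1, fun n => (ct n).2, hct⟩

lemma SigmaConv.comp {T : ℝ} {x : ℕ → ℝ → ℝ} {x₀ : ℝ → ℝ} (h : SigmaConv T x x₀) {φ : ℕ → ℕ}
    (hφ : StrictMono φ) : SigmaConv T (fun n => x (φ n)) x₀ :=
  ⟨h.1.comp hφ.tendsto_atTop, fun 𝒜 h𝒜 hc δ hδ => (h.2 𝒜 h𝒜 hc δ hδ).imp fun _ hN n hn =>
    hN (φ n) (hn.trans (hφ.id_le n))⟩

lemma SigmaConv.tendsto_intD {T : ℝ} (hT : 0 < T) {x : ℕ → ℝ → ℝ} {x₀ : ℝ → ℝ}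
    (hx : ∀ n, Cadlag T (x n)) (hx₀ : Cadlag T x₀) (h : SigmaConv T x x₀) {A : ℝ → ℝ}
    (hA : MemA T A) : Tendsto (fun n => intD T (x n) A) atTop (𝓝 (intD T x₀ A)) := by
  obtain ⟨p, q, hpq, -⟩ := hA.exists_stieltjesPair hT
  rw [Metric.tendsto_atTop]
  intro ε hε
  obtain ⟨N, hN⟩ := h.2 {A} (by rintro _ rfl; exact hA) hA.relTauCompact_singleton (ε / 2)
    (half_pos hε)
  refine ⟨N, fun n hn => ?_⟩
  have := hN n hn A rfl
  rw [hpq.intD_sub hT ((hx n).bddMeasOn hT) (hx₀.bddMeasOn hT)] at this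
  rw [Real.dist_eq]
  linarith

/-- The bound of a uniform approximation by step functions passes to the limit. -/
lemma SigmaConv.abs_sub_stepFun_le {T : ℝ} (hT : 0 < T) {x : ℕ → ℝ → ℝ} {x₀ : ℝ → ℝ}
    (hx : ∀ n, Cadlag T (x n)) (hx₀ : Cadlag T x₀) (h : SigmaConv T x x₀) {m : ℕ}
    {c t : ℕ → Fin m → ℝ} {c₀ t₀ : Fin m → ℝ} (ht : ∀ n i, t n i ∈ Icc 0 T)
    (ht₀ : ∀ i, t₀ i ∈ Icc 0 T) (hc : ∀ i, Tendsto (fun n => c n i) atTop (𝓝 (c₀ i)))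
    (htt : ∀ i, Tendsto (fun n => t n i) atTop (𝓝 (t₀ i))) {ε : ℝ}
    (happ : ∀ᶠ n in atTop, ∀ u ∈ Icc 0 T, |x n u - stepFun (c n) (t n) u| ≤ ε) :
    ∀ u ∈ Icc 0 T, |x₀ u - stepFun c₀ t₀ u| ≤ ε := by
  intro u hu
  rcases hu.2.lt_or_eq with huT | rfl
  · refine le_of_forall_pos_le_add fun δ hδ => ?_
    have hs := stepFun_cadlag c₀ t₀ T
    obtain ⟨k, ⟨hk1, hk2⟩, hk⟩ :=
      (((hx₀.eventually_integral_unifMeasure hT ⟨hu.1, huT⟩ (half_pos hδ)).and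
        (hs.eventually_integral_unifMeasure hT ⟨hu.1, huT⟩ (half_pos hδ))).and
        (Ioo_mem_nhdsGT (sub_pos.2 huT))).exists
    have hA := stieltjesPair_ramp hk.1 hu.1 (show u + k ≤ T by linarith [hk.2])
    have hmA : MemA T (ramp u k) := hA.memA hT (continuous_ramp u k) (ramp_zero hk.1 hu.1)
    have hstep : Tendsto (fun n => intD T (stepFun (c n) (t n)) (ramp u k)) atTop
        (𝓝 (intD T (stepFun c₀ t₀) (ramp u k))) := by
      simp_rw [fun n => hmA.intD_stepFun_left hT (c n) (ht n), hmA.intD_stepFun_left hT c₀ ht₀]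
      exact tendsto_finsetSum _ fun i _ => (hc i).mul
        (tendsto_const_nhds.sub ((continuous_ramp u k).continuousAt.tendsto.comp (htt i)))
    have hle : |intD T x₀ (ramp u k) - intD T (stepFun c₀ t₀) (ramp u k)| ≤ ε := by
      refine le_of_tendsto ((h.tendsto_intD hT hx hx₀ hmA).sub hstep).abs ?_
      filter_upwards [happ] with n hn
      have hb := stepFun_bddMeasOn (c n) (t n) T
      have hxb := (hx n).bddMeasOn hT
      rw [← hA.intD_sub hT hxb hb]
      have := hA.abs_intD_le hT (hxb.sub hb) hn
      rwa [unifMeasure_univ hk.1, measureReal_zero_apply, add_zero, mul_one] at this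
    rw [hA.intD_eq hT (hx₀.bddMeasOn hT), hA.intD_eq hT (hs.bddMeasOn hT), integral_zero_measure,
      integral_zero_measure, sub_zero, sub_zero] at hle
    rw [abs_le] at *
    constructor <;> linarith [hk1.1, hk1.2, hk2.1, hk2.2, hle.1, hle.2]
  · have hT₀ : stepFun c₀ t₀ u = ∑ i, c₀ i := stepFun_eq_sum fun i => (ht₀ i).2
    have hlim : Tendsto (fun n => stepFun (c n) (t n) u) atTop (𝓝 (stepFun c₀ t₀ u)) := by
      simp_rw [hT₀, fun n => stepFun_eq_sum (c := c n) fun i => (ht n i).2]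
      exact tendsto_finsetSum _ fun i _ => hc i
    refine le_of_tendsto (h.1.sub hlim).abs ?_
    filter_upwards [happ] with n hn using hn u hu

lemma SigmaConv.exists_sConv_subseq {T : ℝ} (hT : 0 < T) {x : ℕ → ℝ → ℝ} {x₀ : ℝ → ℝ}
    (hx : ∀ n, Cadlag T (x n)) (hx₀ : Cadlag T x₀) (h : SigmaConv T x x₀) :
    ∃ ψ : ℕ → ℕ, StrictMono ψ ∧ SConv T (fun j => x (ψ j)) x₀ := by
  choose m N R c t hct using fun k : ℕ =>
    h.exists_stepFun hT hx hx₀ (Nat.one_div_pos_of_nat (α := ℝ) (n := k))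
  have hcomp : IsCompact (univ.pi fun k => Metric.closedBall (0 : Fin (m k) → ℝ) (R k) ×ˢ
      univ.pi fun _ : Fin (m k) => Icc 0 T) :=
    isCompact_univ_pi fun k => (isCompact_closedBall _ _).prod
      (isCompact_univ_pi fun _ => isCompact_Icc)
  obtain ⟨a, ha, ψ, hψ, hlim⟩ := hcomp.tendsto_subseq (x := fun n k => (c k n, t k n))
    fun n k _ => ⟨(hct k n).1, fun i _ => (hct k n).2.1 i⟩
  have hlimk := fun k => tendsto_pi_nhds.1 hlim k
  have hc : ∀ k i, Tendsto (fun j => c k (ψ j) i) atTop (𝓝 ((a k).1 i)) := fun k i =>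
    tendsto_pi_nhds.1 (hlimk k).fst_nhds i
  have ht : ∀ k i, Tendsto (fun j => t k (ψ j) i) atTop (𝓝 ((a k).2 i)) := fun k i =>
    tendsto_pi_nhds.1 (hlimk k).snd_nhds i
  have ha2 : ∀ k i, (a k).2 i ∈ Icc 0 T := fun k i => (ha k trivial).2 i trivial
  refine ⟨ψ, hψ, fun ε hε => ?_⟩
  obtain ⟨k, hk⟩ := exists_nat_one_div_lt hε
  have hev : ∀ᶠ j in atTop, N k ≤ ψ j := hψ.tendsto_atTop.eventually_ge_atTop (N k)
  choose m' c' t' ht' happ' using fun j => (hx (ψ j)).exists_stepFun hT hε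
  classical
  refine ⟨fun j => if N k ≤ ψ j then stepFun (c k (ψ j)) (t k (ψ j)) else stepFun (c' j) (t' j),
    stepFun (a k).1 (a k).2, fun j => ?_, stepFun_memV _ hT (ha2 k), fun j u hu => ?_,
    fun u hu => ?_, fun f hf => ?_⟩
  · dsimp only
    split_ifs
    · exact stepFun_memV _ hT (hct k (ψ j)).2.1
    · exact stepFun_memV _ hT (ht' j)
  · dsimp only
    split_ifs with hj
    · exact ((hct k (ψ j)).2.2 hj u hu).trans hk.le
    · exact happ' j u hu
  · refine ((h.comp hψ).abs_sub_stepFun_le hT (fun j => hx (ψ j)) hx₀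
      (fun j => (hct k (ψ j)).2.1) (ha2 k) (hc k) (ht k) ?_ u hu).trans hk.le
    filter_upwards [hev] with j hj using (hct k (ψ j)).2.2 hj
  · have hfm : BddMeasOn T f := .of_continuousOn hf.continuousOn
    rw [intD_stepFun _ hT (ha2 k) hfm]
    refine (tendsto_finsetSum _ fun i _ => (hc k i).mul
      (hf.continuousAt.tendsto.comp (ht k i))).congr' ?_
    filter_upwards [hev] with j hj
    rw [if_pos hj, intD_stepFun _ hT (hct k (ψ j)).2.1 hfm]
    rfl

lemma SigmaConv.sStarConv {T : ℝ} (hT : 0 < T) {x : ℕ → ℝ → ℝ} {x₀ : ℝ → ℝ}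
    (hx : ∀ n, Cadlag T (x n)) (hx₀ : Cadlag T x₀) (h : SigmaConv T x x₀) : SStarConv T x x₀ :=
  fun φ hφ => (h.comp hφ).exists_sConv_subseq hT (fun n => hx (φ n)) hx₀

open scoped BoundedContinuousFunction

lemma StieltjesPair.intD_congr {T : ℝ} (hT : 0 < T) {p q : Measure ℝ} {A f g : ℝ → ℝ}
    (h : StieltjesPair T p q A) (hf : BddMeasOn T f) (hg : BddMeasOn T g)
    (hfg : ∀ t ∈ Icc 0 T, f t = g t) : intD T f A = intD T g A := by
  rw [h.intD_eq hT hf, h.intD_eq hT hg,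
    integral_congr_ae ((ae_mem_Icc_of_support h.support_left).mono hfg),
    integral_congr_ae ((ae_mem_Icc_of_support h.support_right).mono hfg)]

lemma BddMeasOn.of_boundedContinuous (T : ℝ) (f : ℝ →ᵇ ℝ) : BddMeasOn T f :=
  .of_continuousOn f.continuous.continuousOn

lemma MemV.exists_stieltjesPair {T : ℝ} (hT : 0 < T) {v : ℝ → ℝ} (hv : MemV T v) :
    ∃ p q : Measure ℝ, StieltjesPair T p q v :=
  let ⟨p, q, h, _⟩ := _root_.exists_stieltjesPair hT hv.1.1 hv.2
  ⟨p, q, h⟩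

lemma MemV.exists_clm {T : ℝ} (hT : 0 < T) {v : ℝ → ℝ} (hv : MemV T v) :
    ∃ L : (ℝ →ᵇ ℝ) →L[ℝ] ℝ, ∀ f, L f = intD T f v := by
  obtain ⟨p, q, h⟩ := hv.exists_stieltjesPair hT
  have := h.finite_left
  have := h.finite_right
  let L : (ℝ →ᵇ ℝ) →ₗ[ℝ] ℝ :=
    { toFun := fun f => ∫ t, f t ∂p - ∫ t, f t ∂q
      map_add' := fun f g => by
        simp only [BoundedContinuousFunction.coe_add, Pi.add_apply]
        rw [integral_add (f.integrable p) (g.integrable p),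
          integral_add (f.integrable q) (g.integrable q)]
        ring
      map_smul' := fun r f => by
        simp only [BoundedContinuousFunction.coe_smul, integral_smul, RingHom.id_apply, smul_sub] }
  have hL : ∀ f, L f = intD T f v := fun f => (h.intD_eq hT (.of_boundedContinuous T f)).symm
  refine ⟨L.mkContinuous (p.real univ + q.real univ) fun f => ?_, hL⟩
  rw [hL, mul_comm]
  exact h.abs_intD_le hT (.of_boundedContinuous T f) fun t _ => f.norm_coe_le_norm t

/-- Weak-* convergence of integrators together with uniform convergence of integrands. -/
lemma tendsto_intD_of_tendsto {T : ℝ} (hT : 0 < T) {v : ℕ → ℝ → ℝ} {v₀ : ℝ → ℝ}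
    (hv : ∀ n, MemV T (v n))
    (hlim : ∀ f : ℝ → ℝ, Continuous f → Tendsto (fun n => intD T f (v n)) atTop
      (𝓝 (intD T f v₀)))
    {G : ℕ → ℝ →ᵇ ℝ} {G₀ : ℝ →ᵇ ℝ} (hG : Tendsto G atTop (𝓝 G₀)) :
    Tendsto (fun n => intD T (G n) (v n)) atTop (𝓝 (intD T G₀ v₀)) := by
  choose L hL using fun n => (hv n).exists_clm hT
  obtain ⟨C, hC⟩ := banach_steinhaus (g := L) fun f => by
    obtain ⟨C, hC⟩ := (hlim f f.continuous).norm.bddAbove_range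
    exact ⟨C, fun n => by rw [hL]; exact hC ⟨n, rfl⟩⟩
  have h0 : Tendsto (fun n => L n (G n - G₀)) atTop (𝓝 0) := by
    have hn : Tendsto (fun n => C * ‖G n - G₀‖) atTop (𝓝 0) := by
      simpa using (tendsto_iff_norm_sub_tendsto_zero.1 hG).const_mul C
    exact squeeze_zero_norm (fun n => (L n).le_of_opNorm_le (hC n) _) hn
  have h1 := h0.add (hlim G₀ G₀.continuous)
  rw [zero_add] at h1
  refine h1.congr fun n => ?_
  rw [map_sub, hL, hL]
  ring

/-- The integrand `s ↦ A(T) - A(s)` obtained after integration by parts. -/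
def tailFun {T : ℝ} (hT : 0 < T) {A : ℝ → ℝ} (hA : MemA T A) : ℝ →ᵇ ℝ :=
  (BoundedContinuousFunction.mkOfCompact
    ⟨fun s : Icc 0 T => A T - A s, continuous_const.sub hA.1.domRestrict⟩).compContinuous
    ⟨projIcc 0 T hT.le, continuous_projIcc⟩

lemma tailFun_apply {T : ℝ} (hT : 0 < T) {A : ℝ → ℝ} (hA : MemA T A) (s : ℝ) :
    tailFun hT hA s = A T - A (projIcc 0 T hT.le s) := rfl

lemma tendsto_tailFun {T : ℝ} (hT : 0 < T) {A : ℕ → ℝ → ℝ} {A₀ : ℝ → ℝ}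
    (hA : ∀ n, MemA T (A n)) (hA₀ : MemA T A₀) (h : TauConv T A A₀) :
    Tendsto (fun n => tailFun hT (hA n)) atTop (𝓝 (tailFun hT hA₀)) := by
  rw [BoundedContinuousFunction.tendsto_iff_tendstoUniformly, Metric.tendstoUniformly_iff]
  intro ε hε
  filter_upwards [Metric.tendstoUniformlyOn_iff.1 h.1 (ε / 2) (half_pos hε)] with n hn s
  rw [tailFun_apply, tailFun_apply]
  have h1 := hn T ⟨hT.le, le_rfl⟩
  have h2 := hn _ (projIcc 0 T hT.le s).2
  linarith [dist_sub_sub_le_of_le h1.le h2.le, dist_sub_sub_le (A₀ T)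
    (A₀ (projIcc 0 T hT.le s)) (A n T) (A n (projIcc 0 T hT.le s))]

lemma MemV.intD_eq_tailFun {T : ℝ} (hT : 0 < T) {v A : ℝ → ℝ} (hv : MemV T v) (hA : MemA T A) :
    intD T v A = intD T (tailFun hT hA) v := by
  obtain ⟨p, q, h, -⟩ := hA.exists_stieltjesPair hT
  obtain ⟨p', q', h'⟩ := hv.exists_stieltjesPair hT
  rw [h'.intD_by_parts hT (hv.1.bddMeasOn hT) h hA.1 hA.2.2]
  refine h'.intD_congr hT (.of_continuousOn (continuousOn_const.sub hA.1))
    (.of_boundedContinuous T _) fun t ht => ?_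
  rw [tailFun_apply, projIcc_of_mem hT.le ht]

lemma SConv.comp {T : ℝ} {x : ℕ → ℝ → ℝ} {x₀ : ℝ → ℝ} (h : SConv T x x₀) {φ : ℕ → ℕ}
    (hφ : StrictMono φ) : SConv T (fun n => x (φ n)) x₀ := fun ε hε =>
  let ⟨v, v₀, h1, h2, h3, h4, h5⟩ := h ε hε
  ⟨fun n => v (φ n), v₀, fun n => h1 (φ n), h2, fun n => h3 (φ n), h4,
    fun f hf => (h5 f hf).comp hφ.tendsto_atTop⟩

lemma SConv.sStarConv {T : ℝ} {x : ℕ → ℝ → ℝ} {x₀ : ℝ → ℝ} (h : SConv T x x₀) :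
    SStarConv T x x₀ := fun _ hφ => ⟨id, strictMono_id, h.comp hφ⟩

lemma MemV.intD_one {T : ℝ} (hT : 0 < T) {v : ℝ → ℝ} (hv : MemV T v) :
    intD T (fun _ => 1) v = v T := by
  obtain ⟨p, q, h⟩ := hv.exists_stieltjesPair hT
  have huniv : ∀ r : Measure ℝ, r (Icc 0 T)ᶜ = 0 → r.real univ = r.real (Icc 0 T) := fun r hr =>
    measureReal_congr (ae_eq_univ.2 hr).symm
  rw [h.intD_eq hT (.of_continuousOn continuousOn_const), h.eq_sub T ⟨hT.le, le_rfl⟩,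
    integral_const, integral_const, huniv p h.support_left, huniv q h.support_right]
  simp

lemma SConv.tendsto_right_end {T : ℝ} (hT : 0 < T) {x : ℕ → ℝ → ℝ} {x₀ : ℝ → ℝ}
    (h : SConv T x x₀) : Tendsto (fun n => x n T) atTop (𝓝 (x₀ T)) := by
  rw [Metric.tendsto_atTop']
  intro ε hε
  obtain ⟨v, v₀, hv, hv₀, hxv, hxv₀, hlim⟩ := h (ε / 3) (by positivity)
  have h1 := hlim (fun _ => 1) continuous_const
  simp_rw [fun n => (hv n).intD_one hT, hv₀.intD_one hT] at h1
  obtain ⟨N, hN⟩ := Metric.tendsto_atTop'.1 h1 (ε / 3) (by positivity)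
  refine ⟨N, fun n hn => ?_⟩
  have h2 := hN n hn
  have h3 := hxv n T ⟨hT.le, le_rfl⟩
  have h4 := hxv₀ T ⟨hT.le, le_rfl⟩
  rw [Real.dist_eq, abs_lt] at *
  rw [abs_le] at h3 h4
  constructor <;> linarith [h2.1, h2.2, h3.1, h3.2, h4.1, h4.2]

lemma SConv.tendsto_intD {T : ℝ} (hT : 0 < T) {x : ℕ → ℝ → ℝ} {x₀ : ℝ → ℝ}
    (hx : ∀ n, Cadlag T (x n)) (hx₀ : Cadlag T x₀) (h : SConv T x x₀)
    {A : ℕ → ℝ → ℝ} {A₀ : ℝ → ℝ} (hA : ∀ n, MemA T (A n)) (hA₀ : MemA T A₀)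
    (hτ : TauConv T A A₀) :
    Tendsto (fun n => intD T (fun u => x n u - x₀ u) (A n)) atTop (𝓝 0) := by
  obtain ⟨M, hM⟩ := hτ.2
  have hM' : ∀ n, (eVariationOn (A n) (Icc 0 T)).toReal ≤ max M 0 := fun n =>
    ENNReal.toReal_le_of_le_ofReal (le_max_right _ _)
      ((hM n).trans (ENNReal.ofReal_le_ofReal (le_max_left _ _)))
  choose p q hpq hmass using fun n => (hA n).exists_stieltjesPair hT
  set W := 3 * max M 0 with hW
  have hW0 : 0 ≤ W := by positivity
  have hmassW : ∀ n, (p n).real univ + (q n).real univ ≤ W := fun n =>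
    (hmass n).trans (by rw [hW]; gcongr; exact hM' n)
  rw [Metric.tendsto_atTop']
  intro ε hε
  set e := ε / (4 * (W + 1)) with he
  have he0 : 0 < e := by positivity
  have heW : e * W ≤ ε / 4 := by
    rw [he, div_mul_eq_mul_div, div_le_iff₀ (by positivity)]
    nlinarith
  obtain ⟨v, v₀, hv, hv₀, hxv, hxv₀, hlim⟩ := h e he0
  have hG := tendsto_tailFun hT hA hA₀ hτ
  have h1 := (tendsto_intD_of_tendsto hT hv hlim hG).sub
    (tendsto_intD_of_tendsto hT (fun _ => hv₀) (fun _ _ => tendsto_const_nhds) hG)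
  rw [sub_self] at h1
  simp_rw [fun n => ((hv n).intD_eq_tailFun hT (hA n)).symm,
    fun n => (hv₀.intD_eq_tailFun hT (hA n)).symm] at h1
  obtain ⟨N, hN⟩ := Metric.tendsto_atTop'.1 h1 (ε / 2) (by positivity)
  refine ⟨N, fun n hn => ?_⟩
  have h2 := hN n hn
  have hxm := (hx n).bddMeasOn hT
  have hx₀m := hx₀.bddMeasOn hT
  have hvm := (hv n).1.bddMeasOn hT
  have hv₀m := hv₀.1.bddMeasOn hT
  have h3 := (hpq n).abs_intD_le hT (hxm.sub hvm) (hxv n)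
  have h4 := (hpq n).abs_intD_le hT (hx₀m.sub hv₀m) hxv₀
  have h5 : e * ((p n).real univ + (q n).real univ) ≤ ε / 4 :=
    (mul_le_mul_of_nonneg_left (hmassW n) he0.le).trans heW
  rw [(hpq n).intD_sub hT hxm hvm] at h3
  rw [(hpq n).intD_sub hT hx₀m hv₀m] at h4
  rw [(hpq n).intD_sub hT hxm hx₀m]
  rw [Real.dist_eq, sub_zero, abs_lt] at *
  rw [abs_le] at h3 h4
  constructor <;> linarith [h2.1, h2.2, h3.1, h3.2, h4.1, h4.2]

lemma SStarConv.sigmaConv {T : ℝ} (hT : 0 < T) {x : ℕ → ℝ → ℝ} {x₀ : ℝ → ℝ}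
    (hx : ∀ n, Cadlag T (x n)) (hx₀ : Cadlag T x₀) (h : SStarConv T x x₀) :
    SigmaConv T x x₀ := by
  refine ⟨tendsto_of_subseq_tendsto fun ns hns => ?_, fun 𝒜 h𝒜 hcomp δ hδ => ?_⟩
  · obtain ⟨φ, hφ, hφ'⟩ := strictMono_subseq_of_tendsto_atTop hns
    obtain ⟨ψ, hψ, hs⟩ := h _ hφ'
    exact ⟨fun n => φ (ψ n), hs.tendsto_right_end hT⟩
  · by_contra! hcon
    choose n hn A hA hlarge using hcon
    obtain ⟨φ, hφ, hφ'⟩ := strictMono_subseq_of_tendsto_atTop (tendsto_atTop_mono hn tendsto_id)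
    obtain ⟨ψ, hψ, hs⟩ := h _ hφ'
    obtain ⟨χ, hχ, A₀, hA₀, hτ⟩ := hcomp (fun k => A (φ (ψ k))) fun k => hA _
    have hlim := (hs.comp hχ).tendsto_intD hT (fun _ => hx _) hx₀ (fun _ => h𝒜 _ (hA _)) hA₀ hτ
    obtain ⟨k, hk⟩ := (hlim.abs.eventually_lt_const
      (show |(0 : ℝ)| < δ by rwa [abs_zero])).exists
    exact lt_asymm hk (hlarge _)

lemma SigmaOpen.sOpen {T : ℝ} (hT : 0 < T) {U : Set (ℝ → ℝ)} (hU : SigmaOpen T U) :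
    SOpen T U := by
  refine ⟨hU.1, fun x hx x₀ hx₀ hs hmem => ?_⟩
  obtain ⟨δ, hδ, 𝒜, h𝒜, hcomp, hy⟩ := hU.2 x₀ hmem
  obtain ⟨hend, hint⟩ := hs.sStarConv.sigmaConv hT (fun n => (hx n).1) hx₀
  obtain ⟨N, hN⟩ := hint 𝒜 h𝒜 hcomp (δ / 2) (half_pos hδ)
  obtain ⟨n, hn, hnN⟩ := ((Metric.tendsto_nhds.1 hend δ hδ).and (eventually_ge_atTop N)).exists
  exact (hx n).2 (hy (x n) (hx n).1 hn fun A hA => (hN n hnN A hA).trans_lt (half_lt_self hδ))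

/-- Remark 3.5: `Σ`-convergence of sequences coincides with `⇒*_S`, and `Σ` is
coarser than the `S` topology. -/
theorem stmt4 (T : ℝ) (hT : 0 < T) :
    (∀ x : ℕ → ℝ → ℝ, ∀ x₀ : ℝ → ℝ, (∀ n, Cadlag T (x n)) → Cadlag T x₀ →
      (SStarConv T x x₀ ↔
        (Filter.Tendsto (fun n => x n T) Filter.atTop (nhds (x₀ T)) ∧
          ∀ 𝒜 : Set (ℝ → ℝ), (∀ A ∈ 𝒜, MemA T A) → RelTauCompact T 𝒜 →
            ∀ δ > (0:ℝ), ∃ N : ℕ, ∀ n ≥ N, ∀ A ∈ 𝒜,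
              |intD T (fun u => x n u - x₀ u) A| ≤ δ)))
    ∧
    (∀ U : Set (ℝ → ℝ), SigmaOpen T U → SOpen T U) := by
  exact ⟨fun _ _ hx hx₀ => ⟨fun h => h.sigmaConv hT hx hx₀,
    fun h => SigmaConv.sStarConv hT hx hx₀ h⟩, fun _ hU => hU.sOpen hT⟩

end
end

section
/- L^p(μ) topologies for atomless μ are coarser than S (Remark 4.3): Let μ be a finite atomless Borel measure on [0,T] and let p ∈ [1, ∞). If x_n ⇒*_S x_0 in D([0,T]), then ∫_0^T |x_n(t) − x_0(t)|^p dμ(t) → 0; consequently, the topology on D([0,T]) induced by the L^p([0,T], μ) seminorm is coarser than the S topology. -/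
open MeasureTheory Filter Set Topology

noncomputable section

/-- A càdlàg function of bounded variation on `[0,T]` induces a Lebesgue–Stieltjes signed
measure. -/
theorem exists_represents {T : ℝ} (hT : 0 ≤ T) {v : ℝ → ℝ} (hv : MemV T v) :
    ∃ ν : SignedMeasure ℝ, Represents T ν v := by
  set g : ℝ → ℝ := v ∘ fun t => max 0 (min T t) with hg
  have hgv : ∀ t ∈ Icc 0 T, g t = v t := fun t ht => by
    simp only [hg, Function.comp_apply]
    rw [min_eq_right ht.2, max_eq_right ht.1]
  have hbv : BoundedVariationOn g univ := by
    refine ne_top_of_le_ne_top hv.2 (eVariationOn.comp_le_of_monotoneOn v _ ?_ ?_)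
    · exact fun a _ b _ hab => max_le_max le_rfl (min_le_min le_rfl hab)
    · exact fun t _ => ⟨le_max_left _ _, max_le hT (min_le_left _ _)⟩
  have hlim : ∀ t ∈ Icc 0 T, g.rightLim t = v t := fun t ht => by
    refine rightLim_eq_of_tendsto ?_
    rcases ht.2.eq_or_lt with rfl | htT
    · refine tendsto_const_nhds.congr' ?_
      filter_upwards [self_mem_nhdsWithin] with s hs
      simp only [hg, Function.comp_apply]
      rw [min_eq_left (le_of_lt hs), max_eq_right hT]
    · refine (hv.1.1 t ⟨ht.1, htT⟩).congr' ?_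
      filter_upwards [Ioo_mem_nhdsGT htT] with s hs
      exact (hgv s ⟨ht.1.trans hs.1.le, hs.2.le⟩).symm
  refine ⟨hbv.vectorMeasure.restrict (Ioc 0 T) + VectorMeasure.dirac 0 (v 0), ?_, ?_⟩
  · intro t ht
    have hI : Icc 0 t ∩ Ioc 0 T = Ioc 0 t := by
      ext s
      simp only [mem_inter_iff, mem_Icc, mem_Ioc]
      exact ⟨fun h => ⟨h.2.1, h.1.2⟩, fun h => ⟨⟨h.1.le, h.2⟩, h.1, h.2.trans ht.2⟩⟩
    rw [add_apply, VectorMeasure.restrict_apply _ measurableSet_Ioc measurableSet_Icc,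
      hI, hbv.vectorMeasure_Ioc ht.1, hlim t ht, hlim 0 ⟨le_rfl, hT⟩,
      VectorMeasure.dirac_apply_of_mem measurableSet_Icc ⟨le_rfl, ht.1⟩]
    ring
  · intro s hs hsT
    have h0 : (0 : ℝ) ∉ s := fun h => (hsT ▸ ⟨h, le_rfl, hT⟩ : (0 : ℝ) ∈ (∅ : Set ℝ))
    have hI : s ∩ Ioc 0 T = ∅ :=
      subset_empty_iff.1 (hsT ▸ inter_subset_inter_right s Ioc_subset_Icc_self)
    rw [add_apply, VectorMeasure.restrict_apply _ measurableSet_Ioc hs, hI,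
      VectorMeasure.dirac_apply_of_notMem h0]
    simp

/-- The distribution function of a signed measure. -/
def distFun (ν : SignedMeasure ℝ) (t : ℝ) : ℝ :=
  ν.toJordanDecomposition.posPart.real (Iic t) - ν.toJordanDecomposition.negPart.real (Iic t)

theorem Represents.eq_distFun {T : ℝ} {ν : SignedMeasure ℝ} {v : ℝ → ℝ}
    (h : Represents T ν v) {t : ℝ} (ht : t ∈ Icc 0 T) : v t = distFun ν t := by
  rw [distFun, ← SignedMeasure.apply_eq_posPart_real_sub_negPart_real _ measurableSet_Iic,
    ← h.1 t ht, ← Iio_union_Icc_eq_Iic ht.1,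
    VectorMeasure.of_union (by
      rw [Set.disjoint_left]
      exact fun s hs hs' => (not_le.2 hs) hs'.1) measurableSet_Iio measurableSet_Icc,
    h.2 (Iio 0) measurableSet_Iio (by
      ext s
      simp only [mem_inter_iff, mem_Iio, mem_Icc, mem_empty_iff_false, iff_false]
      exact fun hs => (not_le.2 hs.1) hs.2.1), zero_add]

/-- The signed measure chosen in the definition of `intD`. -/
theorem exists_represents_intD_eq {T : ℝ} (hT : 0 ≤ T) {v : ℝ → ℝ} (hv : MemV T v) :
    ∃ ν : SignedMeasure ℝ, Represents T ν v ∧ ∀ f, intD T f v = sInt ν f := by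
  have h := exists_represents hT hv
  exact ⟨h.choose, h.choose_spec, fun f => by simp only [intD, dif_pos h]⟩

/-- The cumulative distribution function of the total variation measure. -/
def varFun (ν : SignedMeasure ℝ) (t : ℝ) : ℝ :=
  ν.toJordanDecomposition.posPart.real (Iic t) + ν.toJordanDecomposition.negPart.real (Iic t)

/-- The total mass of a signed measure. -/
def totalMass (ν : SignedMeasure ℝ) : ℝ :=
  ν.toJordanDecomposition.posPart.real univ + ν.toJordanDecomposition.negPart.real univ

theorem monotone_real_Iic (P : Measure ℝ) [IsFiniteMeasure P] :
    Monotone fun t => P.real (Iic t) :=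
  fun _ _ h => measureReal_mono (Iic_subset_Iic.2 h)

theorem abs_distFun_sub_le (ν : SignedMeasure ℝ) {s t : ℝ} (h : s ≤ t) :
    |distFun ν t - distFun ν s| ≤ varFun ν t - varFun ν s := by
  have h1 := monotone_real_Iic ν.toJordanDecomposition.posPart h
  have h2 := monotone_real_Iic ν.toJordanDecomposition.negPart h
  simp only [distFun, varFun] at *
  rw [abs_le]
  constructor <;> linarith

theorem varFun_nonneg (ν : SignedMeasure ℝ) (t : ℝ) : 0 ≤ varFun ν t :=
  add_nonneg measureReal_nonneg measureReal_nonneg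

theorem varFun_le_totalMass (ν : SignedMeasure ℝ) (t : ℝ) : varFun ν t ≤ totalMass ν :=
  add_le_add (measureReal_mono (subset_univ _)) (measureReal_mono (subset_univ _))

theorem abs_distFun_le_totalMass (ν : SignedMeasure ℝ) (t : ℝ) :
    |distFun ν t| ≤ totalMass ν := by
  have h1 : 0 ≤ ν.toJordanDecomposition.posPart.real (Iic t) := measureReal_nonneg
  have h2 : 0 ≤ ν.toJordanDecomposition.negPart.real (Iic t) := measureReal_nonneg
  refine le_trans ?_ (varFun_le_totalMass ν t)
  simp only [distFun, varFun]
  rw [abs_le]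
  constructor <;> linarith

theorem measurable_distFun (ν : SignedMeasure ℝ) : Measurable (distFun ν) :=
  (monotone_real_Iic _).measurable.sub (monotone_real_Iic _).measurable

theorem integrable_distFun (ν : SignedMeasure ℝ) (μ : Measure ℝ) [IsFiniteMeasure μ] :
    Integrable (distFun ν) μ :=
  Integrable.of_bound (measurable_distFun ν).aestronglyMeasurable (totalMass ν)
    (Eventually.of_forall fun t => abs_distFun_le_totalMass ν t)

/-- The total mass is dominated by the norm of the functional on bounded continuous functions. -/
theorem totalMass_le_of_forall_sInt_le {ν : SignedMeasure ℝ} {C : ℝ}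
    (h : ∀ f : ℝ → ℝ, Continuous f → (∀ t, |f t| ≤ 1) → sInt ν f ≤ C) : totalMass ν ≤ C := by
  refine le_of_forall_pos_le_add fun ε hε => ?_
  set P := ν.toJordanDecomposition.posPart with hP
  set N := ν.toJordanDecomposition.negPart with hN
  obtain ⟨S, hS, hPS, hNS⟩ := ν.toJordanDecomposition.mutuallySingular
  classical
  set g : ℝ → ℝ := S.piecewise (fun _ => -1) (fun _ => 1) with hg
  have hgm : Measurable g := measurable_const.piecewise hS measurable_const
  have hgb : ∀ t, -1 ≤ g t ∧ g t ≤ 1 := fun t => by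
    by_cases ht : t ∈ S <;> simp [hg, ht]
  have hgi : Integrable g (P + N) :=
    Integrable.of_bound hgm.aestronglyMeasurable 1 (Eventually.of_forall fun t => abs_le.2 (hgb t))
  obtain ⟨f, hf, hfi⟩ := hgi.exists_boundedContinuous_integral_sub_le hε
  set k : ℝ → ℝ := fun t => max (-1) (min 1 (f t)) with hk
  have hkc : Continuous k := continuous_const.max (continuous_const.min f.continuous)
  have hkb : ∀ t, |k t| ≤ 1 := fun t =>
    abs_le.2 ⟨le_max_left _ _, max_le (by norm_num) (min_le_left _ _)⟩
  have hkg : ∀ t, |g t - k t| ≤ ‖g t - f t‖ := fun t => by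
    have := hgb t
    rw [Real.norm_eq_abs, hk]
    grind
  have hki : ∀ (Q : Measure ℝ) [IsFiniteMeasure Q], Integrable k Q := fun Q _ =>
    Integrable.of_bound hkc.aestronglyMeasurable 1 (Eventually.of_forall hkb)
  have hgkP : ∫ t, |g t - k t| ∂P + ∫ t, |g t - k t| ∂N ≤ ε := by
    have hi := (hgi.sub (hki (P + N))).abs
    simp only [Pi.sub_apply] at hi
    rw [← integral_add_measure hi.left_of_add_measure hi.right_of_add_measure]
    exact (integral_mono hi (hgi.sub hfi).norm hkg).trans hf
  have h1 : P.real univ - ∫ t, k t ∂P ≤ ∫ t, |g t - k t| ∂P := by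
    have : P.real univ = ∫ t, (1 : ℝ) ∂P := by simp
    rw [this, ← integral_sub (integrable_const _) (hki P)]
    refine integral_mono_ae ((integrable_const _).sub (hki P))
      ((hgi.left_of_add_measure.sub (hki P)).abs) ?_
    have : ∀ᵐ t ∂P, t ∉ S := measure_eq_zero_iff_ae_notMem.1 hPS
    filter_upwards [this] with t ht
    simpa [hg, ht] using le_abs_self (1 - k t)
  have h2 : N.real univ + ∫ t, k t ∂N ≤ ∫ t, |g t - k t| ∂N := by
    have : N.real univ = ∫ t, (1 : ℝ) ∂N := by simp
    rw [this, ← integral_add (integrable_const _) (hki N)]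
    refine integral_mono_ae ((integrable_const _).add (hki N))
      ((hgi.right_of_add_measure.sub (hki N)).abs) ?_
    have : ∀ᵐ t ∂N, t ∉ Sᶜ := measure_eq_zero_iff_ae_notMem.1 hNS
    filter_upwards [this] with t ht
    have ht' : t ∈ S := not_not.1 ht
    have := neg_abs_le (-1 - k t)
    simp only [hg, Set.piecewise_eq_of_mem _ _ _ ht']
    linarith
  have h3 : ∫ t, k t ∂P - ∫ t, k t ∂N ≤ C := h k hkc hkb
  simp only [totalMass]
  linarith

/-- Integration of bounded continuous functions against a signed measure as a continuous linear
functional. -/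
def sIntCLM (ν : SignedMeasure ℝ) : (BoundedContinuousFunction ℝ ℝ) →L[ℝ] ℝ :=
  LinearMap.mkContinuous
    { toFun := fun f => sInt ν f
      map_add' := fun f g => by
        simp only [sInt, BoundedContinuousFunction.coe_add, Pi.add_apply]
        rw [integral_add (f.integrable _) (g.integrable _),
          integral_add (f.integrable _) (g.integrable _)]
        ring
      map_smul' := fun c f => by
        simp only [sInt, BoundedContinuousFunction.coe_smul, RingHom.id_apply, integral_smul,
          smul_sub] }
    (totalMass ν) fun f => by
      have h1 := f.norm_integral_le_mul_norm (μ := ν.toJordanDecomposition.posPart)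
      have h2 := f.norm_integral_le_mul_norm (μ := ν.toJordanDecomposition.negPart)
      have h3 := norm_sub_le (∫ t, f t ∂ν.toJordanDecomposition.posPart)
        (∫ t, f t ∂ν.toJordanDecomposition.negPart)
      simp only [LinearMap.coe_mk, AddHom.coe_mk, sInt, totalMass]
      rw [add_mul]
      linarith

/-- Weakly-* convergent sequences of signed measures have bounded total masses. -/
theorem exists_totalMass_le {ν : ℕ → SignedMeasure ℝ} {l : (ℝ → ℝ) → ℝ}
    (h : ∀ f : ℝ → ℝ, Continuous f → Tendsto (fun n => sInt (ν n) f) atTop (𝓝 (l f))) :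
    ∃ C, ∀ n, totalMass (ν n) ≤ C := by
  obtain ⟨C, hC⟩ := banach_steinhaus (g := fun n => sIntCLM (ν n)) fun f => by
    obtain ⟨K, hK⟩ := (h f f.continuous).norm.bddAbove_range
    exact ⟨K, fun n => hK ⟨n, rfl⟩⟩
  refine ⟨C, fun n => totalMass_le_of_forall_sInt_le fun f hf hf1 => ?_⟩
  let F : BoundedContinuousFunction ℝ ℝ := BoundedContinuousFunction.ofNormedAddCommGroup f hf 1 hf1
  have hF : ‖F‖ ≤ 1 := BoundedContinuousFunction.norm_ofNormedAddCommGroup_le hf zero_le_one hf1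
  have h0 : 0 ≤ C := (norm_nonneg _).trans (hC n)
  calc sInt (ν n) f ≤ ‖sIntCLM (ν n) F‖ := le_abs_self _
    _ ≤ ‖sIntCLM (ν n)‖ * ‖F‖ := ContinuousLinearMap.le_opNorm _ _
    _ ≤ C * 1 := mul_le_mul (hC n) hF (norm_nonneg _) h0
    _ = C := mul_one C

/-- Tonelli's theorem for the half-plane `s ≤ t`. -/
theorem integral_real_Iic_eq (P μ : Measure ℝ) [IsFiniteMeasure P] [IsFiniteMeasure μ] :
    ∫ t, P.real (Iic t) ∂μ = ∫ s, μ.real (Ici s) ∂P := by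
  have hS : MeasurableSet {q : ℝ × ℝ | q.2 ≤ q.1} := measurableSet_le measurable_snd measurable_fst
  have h1 := Measure.prod_apply (μ := μ) (ν := P) hS
  rw [Measure.prod_apply_symm hS] at h1
  have h2 := measurable_measure_prodMk_left (ν := P) hS
  have h3 := measurable_measure_prodMk_right (μ := μ) hS
  change ∫ t, (P (Prod.mk t ⁻¹' {q : ℝ × ℝ | q.2 ≤ q.1})).toReal ∂μ =
    ∫ s, (μ ((fun t => (t, s)) ⁻¹' {q : ℝ × ℝ | q.2 ≤ q.1})).toReal ∂P
  rw [integral_toReal h2.aemeasurable (Eventually.of_forall fun _ => measure_lt_top _ _),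
    integral_toReal h3.aemeasurable (Eventually.of_forall fun _ => measure_lt_top _ _)]
  rw [h1]

theorem integral_distFun_eq (ν : SignedMeasure ℝ) (μ : Measure ℝ) [IsFiniteMeasure μ] :
    ∫ t, distFun ν t ∂μ = sInt ν fun s => μ.real (Ici s) := by
  have hi : ∀ (P : Measure ℝ) [IsFiniteMeasure P], Integrable (fun t => P.real (Iic t)) μ :=
    fun P _ => Integrable.of_bound (monotone_real_Iic P).measurable.aestronglyMeasurable
      (P.real univ) (Eventually.of_forall fun t => by
        rw [Real.norm_eq_abs, abs_of_nonneg measureReal_nonneg]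
        exact measureReal_mono (subset_univ _))
  simp only [distFun, sInt]
  rw [integral_sub (hi _) (hi _), integral_real_Iic_eq, integral_real_Iic_eq]

theorem continuous_real_Iic (μ : Measure ℝ) [IsFiniteMeasure μ] [NullSingletonClass μ] :
    Continuous fun t => μ.real (Iic t) := by
  have h := (intervalIntegral.continuous_primitive (μ := μ) (f := fun _ => (1 : ℝ))
    (fun a b => intervalIntegrable_const) 0).add_const (μ.real (Iic 0))
  refine h.congr fun t => ?_
  rw [← intervalIntegral.integral_Iic_sub_Iic (integrable_const _).integrableOn
    (integrable_const _).integrableOn]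
  simp

theorem continuous_real_Ici (μ : Measure ℝ) [IsFiniteMeasure μ] [NullSingletonClass μ] :
    Continuous fun t => μ.real (Ici t) := by
  refine (Continuous.sub (continuous_const (y := μ.real univ)) (continuous_real_Iic μ)).congr
    fun t => ?_
  simp only [Pi.sub_apply]
  rw [← measureReal_compl measurableSet_Iic, compl_Iic]
  exact measureReal_congr Ioi_ae_eq_Ici

/-- If `w` oscillates by at most `L` on `(a,b]`, its `L¹` norm there is controlled by its mean. -/
theorem integral_abs_le_abs_integral_add {μ : Measure ℝ} [IsFiniteMeasure μ] {w : ℝ → ℝ}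
    (hw : Integrable w μ) {a b L : ℝ} (hab : a ≤ b)
    (hL : ∀ s ∈ Ioc a b, ∀ t ∈ Ioc a b, |w t - w s| ≤ L) :
    ∫ t in a..b, |w t| ∂μ ≤ |∫ t in a..b, w t ∂μ| + μ.real (Ioc a b) * L := by
  rw [intervalIntegral.integral_of_le hab, intervalIntegral.integral_of_le hab]
  set J := ∫ t in Ioc a b, w t ∂μ
  set m := μ.real (Ioc a b) with hm
  have hm0 : 0 ≤ m := measureReal_nonneg
  rcases hm0.eq_or_lt with h0 | h0
  · have : μ (Ioc a b) = 0 := (measureReal_eq_zero_iff).1 h0.symm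
    rw [Measure.restrict_eq_zero.2 this, integral_zero_measure, ← h0, zero_mul, add_zero]
    exact abs_nonneg _
  have hbound : ∀ t ∈ Ioc a b, |w t| ≤ |J| / m + L := fun t ht => by
    have h1 : ∫ s in Ioc a b, (w t - w s) ∂μ = m * w t - J := by
      rw [integral_sub (integrable_const _) hw.integrableOn]
      simp [hm, J]
    have h2 := norm_setIntegral_le_of_norm_le_const (μ := μ) (s := Ioc a b) (C := L)
      (f := fun s => w t - w s) (measure_lt_top _ _) fun s hs => hL s hs t ht
    rw [h1, Real.norm_eq_abs] at h2
    have h3 : m * |w t| ≤ |J| + L * m := by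
      have h4 := abs_sub_abs_le_abs_sub (m * w t) J
      rw [abs_mul, abs_of_pos h0] at h4
      linarith
    rw [div_add' _ _ _ h0.ne', le_div_iff₀ h0]
    linarith
  have h5 := norm_setIntegral_le_of_norm_le_const (μ := μ) (s := Ioc a b)
    (f := fun s => |w s|) (measure_lt_top _ _) fun s hs => by
      rw [Real.norm_eq_abs, abs_abs]
      exact hbound s hs
  refine (le_abs_self _).trans (h5.trans (le_of_eq ?_))
  rw [← hm, add_mul, div_mul_cancel₀ _ h0.ne', mul_comm L]

/-- An atomless finite measure gives small mass to the cells of a fine equidistant partition. -/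
theorem exists_partition_real_Ioc_le (μ : Measure ℝ) [IsFiniteMeasure μ] [NullSingletonClass μ] {T δ : ℝ}
    (hT : 0 < T) (hδ : 0 < δ) :
    ∃ t : ℕ → ℝ, ∃ m : ℕ, Monotone t ∧ t 0 = 0 ∧ t m = T ∧
      ∀ j < m, μ.real (Ioc (t j) (t (j + 1))) ≤ δ := by
  have huc := isCompact_Icc.uniformContinuousOn_of_continuous
    (s := Icc 0 T) (continuous_real_Iic μ).continuousOn
  obtain ⟨η, hη, h⟩ := Metric.uniformContinuousOn_iff.1 huc δ hδ
  obtain ⟨m, hm⟩ := exists_nat_gt (T / η)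
  have hm0 : (0 : ℝ) < m := (div_pos hT hη).trans hm
  have hTm : 0 < T / m := div_pos hT hm0
  have hmono : Monotone fun j : ℕ => j * (T / m) := fun i j hij =>
    mul_le_mul_of_nonneg_right (Nat.cast_le.2 hij) hTm.le
  have htm : (m : ℝ) * (T / m) = T := by field_simp
  refine ⟨fun j => j * (T / m), m, hmono, by simp, htm, fun j hj => ?_⟩
  have hle : ∀ i ≤ m, (i : ℝ) * (T / m) ∈ Icc 0 T := fun i hi =>
    ⟨mul_nonneg (Nat.cast_nonneg i) hTm.le, (hmono hi).trans htm.le⟩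
  have hd := h _ (hle (j + 1) hj) _ (hle j hj.le) (by
    rw [Real.dist_eq, ← sub_mul, Nat.cast_succ, add_sub_cancel_left, one_mul, abs_of_pos hTm]
    rwa [div_lt_comm₀ hm0 hη])
  rw [← Iic_sdiff_Iic, measureReal_sdiff (Iic_subset_Iic.2 (hmono j.le_succ)) measurableSet_Iic]
  exact (le_abs_self _).trans hd.le

/-- Weak-* convergence of signed measures implies `L¹(μ)`-convergence of their distribution
functions when `μ` is finite and atomless. -/
theorem tendsto_integral_abs_distFun_sub (μ : Measure ℝ) [IsFiniteMeasure μ] [NullSingletonClass μ] {T : ℝ}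
    (hT : 0 < T) {ν : ℕ → SignedMeasure ℝ} {ν₀ : SignedMeasure ℝ}
    (h : ∀ f : ℝ → ℝ, Continuous f → Tendsto (fun n => sInt (ν n) f) atTop (𝓝 (sInt ν₀ f))) :
    Tendsto (fun n => ∫ t in (0)..T, |distFun (ν n) t - distFun ν₀ t| ∂μ) atTop (𝓝 0) := by
  obtain ⟨C, hC⟩ := exists_totalMass_le h
  have hint : ∀ n, Integrable (fun t => distFun (ν n) t - distFun ν₀ t) μ := fun n =>
    (integrable_distFun _ _).sub (integrable_distFun _ _)
  have hcell : ∀ a b : ℝ, a ≤ b →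
      Tendsto (fun n => |∫ t in a..b, (distFun (ν n) t - distFun ν₀ t) ∂μ|) atTop (𝓝 0) := by
    intro a b hab
    have h1 := h _ (continuous_real_Ici (μ.restrict (Ioc a b)))
    rw [← tendsto_sub_nhds_zero_iff] at h1
    refine (tendsto_zero_iff_abs_tendsto_zero _).1 (h1.congr fun n => ?_)
    rw [intervalIntegral.integral_of_le hab,
      integral_sub (integrable_distFun _ _) (integrable_distFun _ _), integral_distFun_eq,
      integral_distFun_eq]
  rw [Metric.tendsto_nhds]
  intro ε hε
  set K := C + totalMass ν₀ with hK
  have hK0 : 0 ≤ K :=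
    add_nonneg (((varFun_nonneg _ 0).trans (varFun_le_totalMass _ 0)).trans (hC 0))
      ((varFun_nonneg _ 0).trans (varFun_le_totalMass _ 0))
  obtain ⟨t, m, hmono, ht0, htm, ht⟩ :=
    exists_partition_real_Ioc_le μ hT (div_pos (half_pos hε) (by linarith : 0 < K + 1))
  set δ := ε / 2 / (K + 1) with hδ
  have hδK : δ * K < ε / 2 := by
    rw [hδ, div_mul_eq_mul_div, div_lt_iff₀ (by linarith)]
    nlinarith
  have hδ0 : 0 ≤ δ := by positivity
  have hsum : Tendsto (fun n => ∑ j ∈ Finset.range m,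
      |∫ s in t j..t (j + 1), (distFun (ν n) s - distFun ν₀ s) ∂μ|) atTop (𝓝 0) := by
    simpa using tendsto_finsetSum (Finset.range m) fun j _ =>
      hcell (t j) (t (j + 1)) (hmono j.le_succ)
  filter_upwards [hsum.eventually_lt_const (half_pos hε)] with n hn
  set w : ℝ → ℝ := fun s => distFun (ν n) s - distFun ν₀ s with hw
  set V : ℝ → ℝ := fun s => varFun (ν n) s + varFun ν₀ s with hV
  have hwV : ∀ s r, s ≤ r → |w r - w s| ≤ V r - V s := fun s r hsr => by
    have h1 := abs_distFun_sub_le (ν n) hsr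
    have h2 := abs_distFun_sub_le ν₀ hsr
    have h3 := abs_sub (distFun (ν n) r - distFun (ν n) s) (distFun ν₀ r - distFun ν₀ s)
    have h4 : w r - w s =
      (distFun (ν n) r - distFun (ν n) s) - (distFun ν₀ r - distFun ν₀ s) := by
      simp only [hw]; ring
    rw [h4]
    simp only [hV]
    linarith
  have hVmono : Monotone V := fun s r hsr => by
    have := (abs_nonneg _).trans (hwV s r hsr)
    linarith
  have hosc : ∀ a b, ∀ s ∈ Ioc a b, ∀ r ∈ Ioc a b, |w r - w s| ≤ V b - V a := by
    intro a b s hs r hr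
    have ha := hVmono hs.1.le
    have hb := hVmono hs.2
    have ha' := hVmono hr.1.le
    have hb' := hVmono hr.2
    rcases le_total s r with hsr | hsr
    · linarith [hwV s r hsr]
    · rw [abs_sub_comm]
      linarith [hwV r s hsr]
  have hVK : V T - V 0 ≤ K := by
    have h1 := varFun_le_totalMass (ν n) T
    have h2 := varFun_le_totalMass ν₀ T
    have h3 := varFun_nonneg (ν n) 0
    have h4 := varFun_nonneg ν₀ 0
    have h5 := hC n
    simp only [hV, hK]
    linarith
  have hmain : ∫ s in (0)..T, |w s| ∂μ ≤
      ∑ j ∈ Finset.range m, |∫ s in t j..t (j + 1), w s ∂μ| + δ * (V T - V 0) := by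
    have hadj := intervalIntegral.sum_integral_adjacent_intervals (μ := μ) (f := fun s => |w s|)
      (a := t) (n := m) fun k _ => (hint n).abs.intervalIntegrable
    rw [ht0, htm] at hadj
    have htel := Finset.sum_range_sub (fun j => V (t j)) m
    simp only [ht0, htm] at htel
    rw [← hadj, ← htel, Finset.mul_sum, ← Finset.sum_add_distrib]
    refine Finset.sum_le_sum fun j hj => ?_
    have hj' := hmono j.le_succ
    refine (integral_abs_le_abs_integral_add (hint n) hj' (hosc _ _)).trans ?_
    gcongr
    · exact sub_nonneg.2 (hVmono hj')
    · exact ht j (Finset.mem_range.1 hj)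
  have hnn : 0 ≤ ∫ s in (0)..T, |w s| ∂μ :=
    intervalIntegral.integral_nonneg hT.le fun s _ => abs_nonneg _
  rw [Real.dist_eq, sub_zero, abs_of_nonneg hnn]
  have := mul_le_mul_of_nonneg_left hVK hδ0
  linarith

/-- The data extracted from S-convergence at level `ε`. -/
theorem SConv.exists_signedMeasure {T : ℝ} (hT : 0 ≤ T) {x : ℕ → ℝ → ℝ} {x₀ : ℝ → ℝ}
    (h : SConv T x x₀) {ε : ℝ} (hε : 0 < ε) :
    ∃ ν : ℕ → SignedMeasure ℝ, ∃ ν₀ : SignedMeasure ℝ,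
      (∀ n, ∀ t ∈ Icc 0 T, |x n t - distFun (ν n) t| ≤ ε) ∧
      (∀ t ∈ Icc 0 T, |x₀ t - distFun ν₀ t| ≤ ε) ∧
      ∀ f : ℝ → ℝ, Continuous f → Tendsto (fun n => sInt (ν n) f) atTop (𝓝 (sInt ν₀ f)) := by
  obtain ⟨v, v₀, hv, hv₀, hx, hx₀, hconv⟩ := h ε hε
  choose ν hν hνi using fun n => exists_represents_intD_eq hT (hv n)
  obtain ⟨ν₀, hν₀, hν₀i⟩ := exists_represents_intD_eq hT hv₀
  refine ⟨ν, ν₀, fun n t ht => ?_, fun t ht => ?_, fun f hf => ?_⟩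
  · rw [← (hν n).eq_distFun ht]
    exact hx n t ht
  · rw [← hν₀.eq_distFun ht]
    exact hx₀ t ht
  · simpa only [hνi, hν₀i] using hconv f hf

/-- An S-convergent sequence is uniformly bounded. -/
theorem SConv.exists_abs_sub_le {T : ℝ} (hT : 0 ≤ T) {x : ℕ → ℝ → ℝ} {x₀ : ℝ → ℝ}
    (h : SConv T x x₀) : ∃ K, 0 < K ∧ ∀ n, ∀ t ∈ Icc 0 T, |x n t - x₀ t| ≤ K := by
  obtain ⟨ν, ν₀, hx, hx₀, hconv⟩ := h.exists_signedMeasure hT one_pos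
  obtain ⟨C, hC⟩ := exists_totalMass_le hconv
  have hb : ∀ n, ∀ t ∈ Icc 0 T, |x n t - x₀ t| ≤ 2 + C + totalMass ν₀ := fun n t ht => by
    have h1 := abs_le.1 (hx n t ht)
    have h2 := abs_le.1 (hx₀ t ht)
    have h3 := abs_le.1 ((abs_distFun_le_totalMass (ν n) t).trans (hC n))
    have h4 := abs_le.1 (abs_distFun_le_totalMass ν₀ t)
    exact abs_le.2 ⟨by linarith, by linarith⟩
  refine ⟨2 + C + totalMass ν₀, ?_, hb⟩
  have h1 := (abs_nonneg _).trans (abs_distFun_le_totalMass (ν 0) 0)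
  have h2 := (abs_nonneg _).trans (abs_distFun_le_totalMass ν₀ 0)
  linarith [hC 0]

/-- S-convergence implies convergence in `L^p(μ)` for finite atomless `μ`. -/
theorem SConv.tendsto_integral_rpow (μ : Measure ℝ) [IsFiniteMeasure μ] [NullSingletonClass μ] {T : ℝ}
    (hT : 0 < T) {p : ℝ} (hp : 1 ≤ p) {x : ℕ → ℝ → ℝ} {x₀ : ℝ → ℝ} (h : SConv T x x₀) :
    Tendsto (fun n => ∫ t in Icc 0 T, |x n t - x₀ t| ^ p ∂μ) atTop (𝓝 0) := by
  obtain ⟨K, hK, hbound⟩ := h.exists_abs_sub_le hT.le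
  set A := K ^ (p - 1) with hA
  have hA0 : 0 < A := Real.rpow_pos_of_pos hK _
  have hnn : ∀ n, 0 ≤ ∫ t in Icc 0 T, |x n t - x₀ t| ^ p ∂μ := fun n =>
    integral_nonneg fun t => Real.rpow_nonneg (abs_nonneg _) _
  rw [Metric.tendsto_nhds]
  intro ε hε
  set m := μ.real (Icc 0 T) with hm
  have hm0 : 0 ≤ m := measureReal_nonneg
  set η := ε / (2 * A * (2 * m + 1)) with hη
  have hη0 : 0 < η := by positivity
  obtain ⟨ν, ν₀, hx, hx₀, hconv⟩ := h.exists_signedMeasure hT.le hη0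
  have hlim := (tendsto_integral_abs_distFun_sub μ hT hconv).eventually_lt_const
    (by positivity : 0 < η)
  filter_upwards [hlim] with n hn
  rw [Real.dist_eq, sub_zero, abs_of_nonneg (hnn n)]
  rw [intervalIntegral.integral_of_le hT.le, ← integral_Icc_eq_integral_Ioc] at hn
  have hwi : Integrable (fun t => |distFun (ν n) t - distFun ν₀ t|) (μ.restrict (Icc 0 T)) :=
    ((integrable_distFun _ _).sub (integrable_distFun _ _)).abs
  have hle : ∫ t in Icc 0 T, |x n t - x₀ t| ^ p ∂μ ≤
      ∫ t in Icc 0 T, A * (2 * η + |distFun (ν n) t - distFun ν₀ t|) ∂μ := by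
    refine integral_mono_of_nonneg
      (Eventually.of_forall fun t => Real.rpow_nonneg (abs_nonneg _) _)
      (((integrable_const _).add hwi).const_mul _) ?_
    filter_upwards [ae_restrict_mem measurableSet_Icc] with t ht
    have h1 : |x n t - x₀ t| ≤ 2 * η + |distFun (ν n) t - distFun ν₀ t| := by
      have h1 := abs_le.1 (hx n t ht)
      have h2 := abs_le.1 (hx₀ t ht)
      have h3 := neg_abs_le (distFun (ν n) t - distFun ν₀ t)
      have h4 := le_abs_self (distFun (ν n) t - distFun ν₀ t)
      exact abs_le.2 ⟨by linarith, by linarith⟩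
    have h2 : |x n t - x₀ t| ^ p = |x n t - x₀ t| ^ (p - 1) * |x n t - x₀ t| := by
      conv_lhs => rw [show p = (p - 1) + 1 by ring]
      rw [Real.rpow_add_of_nonneg (abs_nonneg _) (by linarith) zero_le_one, Real.rpow_one]
    rw [h2]
    exact mul_le_mul (Real.rpow_le_rpow (abs_nonneg _) (hbound n t ht) (by linarith)) h1
      (abs_nonneg _) hA0.le
  rw [integral_const_mul, integral_add (integrable_const _) hwi] at hle
  simp only [integral_const, MeasurableSet.univ, measureReal_restrict_apply, univ_inter,
    smul_eq_mul, ← hm] at hle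
  have hηε : A * (m * (2 * η) + η) = ε / 2 := by
    rw [hη]
    field_simp
  have := mul_lt_mul_of_pos_left (add_lt_add_right hn (m * (2 * η))) hA0
  linarith

/-- Remark 4.3: for a finite atomless Borel measure `μ` on `[0,T]`, the `L^p(μ)`
topologies are coarser than `S`. -/
theorem stmt7 (T : ℝ) (hT : 0 < T) (μ : MeasureTheory.Measure ℝ)
    (hfin : MeasureTheory.IsFiniteMeasure μ) (hatomless : ∀ t : ℝ, μ {t} = 0)
    (p : ℝ) (hp : 1 ≤ p) :
    (∀ x : ℕ → ℝ → ℝ, ∀ x₀ : ℝ → ℝ, (∀ n, Cadlag T (x n)) → Cadlag T x₀ →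
      SStarConv T x x₀ →
      Filter.Tendsto (fun n => ∫ t in Set.Icc (0:ℝ) T, |x n t - x₀ t| ^ p ∂μ)
        Filter.atTop (nhds 0)) ∧
    (∀ U : Set (ℝ → ℝ), U ⊆ Dset T →
      (∀ x₀ ∈ U, ∃ δ > (0:ℝ), ∀ y ∈ Dset T,
        (∫ t in Set.Icc (0:ℝ) T, |y t - x₀ t| ^ p ∂μ) < δ → y ∈ U) →
      SOpen T U) := by
  have : NullSingletonClass μ := ⟨hatomless⟩
  refine ⟨fun x x₀ _ _ hS => ?_, fun U hU hopen => ⟨hU, fun x hx x₀ _ hS hx₀ => ?_⟩⟩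
  · refine tendsto_of_subseq_tendsto fun ns hns => ?_
    obtain ⟨φ, -, hφ⟩ := strictMono_subseq_of_tendsto_atTop hns
    obtain ⟨ψ, -, hψ⟩ := hS (ns ∘ φ) hφ
    exact ⟨φ ∘ ψ, hψ.tendsto_integral_rpow μ hT hp⟩
  · obtain ⟨δ, hδ, hball⟩ := hopen x₀ hx₀
    obtain ⟨n, hn⟩ := ((hS.tendsto_integral_rpow μ hT hp).eventually_lt_const hδ).exists
    exact (hx n).2 (hball (x n) (hx n).1 hn)

end
end
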